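/- Reformulated Chowla–Selberg formula: (1/(24h)) · Σ_{[𝔞] ∈ Cl(E)} log|Δ(𝔞)·Δ(𝔞⁻¹)| = (1/2)·L'(0,χ)/L(0,χ) − (1/2)·log(2π), where the sum runs over a set of fractional-ideal representatives of the ideal classes of E, and L(s,χ) is the analytically continued Dirichlet L-function of χ (which satisfies L(0,χ) ≠ 0). -/

import Mathlib

open NumberField
open scoped nonZeroDivisors

/-- Ramanujan's modular discriminant `Δ(τ) = q ∏_{n ≥ 1} (1 - qⁿ)^24`, `q = e^{2πiτ}`. -/
noncomputable def RamanujanDelta (τ : ℂ) : ℂ :=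
  Complex.exp (2 * Real.pi * Complex.I * τ) *
    ∏' n : ℕ, (1 - Complex.exp (2 * Real.pi * Complex.I * ((n : ℂ) + 1) * τ)) ^ 24

section
open Filter Topology Asymptotics Set MeasureTheory

namespace CSF

/-- The Gaussian antiderivative. -/
noncomputable def Phi (x : ℝ) : ℝ := ∫ v in Iic x, Real.exp (-v ^ 2)

lemma gauss_int : Integrable (fun v : ℝ => Real.exp (-v ^ 2)) := by
  simpa using integrable_exp_neg_mul_sq (b := 1) one_pos

lemma Phi_hasDerivAt (x : ℝ) : HasDerivAt Phi (Real.exp (-x ^ 2)) x := by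
  have h1 : Phi = fun x => (∫ v in Iic (0:ℝ), Real.exp (-v ^ 2)) + ∫ v in (0:ℝ)..x, Real.exp (-v ^ 2) := by
    funext x
    rw [intervalIntegral.integral_Iic_sub_Iic (μ := volume) (a := 0) (b := x)
      gauss_int.integrableOn gauss_int.integrableOn |>.symm]
    simp [Phi]
  rw [h1]
  refine HasDerivAt.const_add _ ?_
  exact intervalIntegral.integral_hasDerivAt_right
    ((by fun_prop : Continuous fun v : ℝ => Real.exp (-v ^ 2)).intervalIntegrable _ _)
    ((by fun_prop : Continuous fun v : ℝ => Real.exp (-v ^ 2)).stronglyMeasurableAtFilter _ _)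
    ((by fun_prop : Continuous fun v : ℝ => Real.exp (-v ^ 2)).continuousAt)

lemma Phi_top : Tendsto Phi atTop (𝓝 (Real.sqrt Real.pi)) := by
  have h := integral_gaussian 1
  simp only [neg_mul, one_mul, div_one] at h
  rw [← h]
  have := (aecover_Iic (μ := volume) (tendsto_id (α := ℝ) (x := atTop))).integral_tendsto_of_countably_generated gauss_int
  exact this

lemma Phi_bot : Tendsto Phi atBot (𝓝 0) := by
  exact tendsto_integral_Iic_zero (a := id) tendsto_id

/-- The Bessel-type kernel. -/
noncomputable def ker (a b t : ℝ) : ℝ := Real.exp (-(a ^ 2 * t + b ^ 2 / t))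

lemma bessel_half {a b : ℝ} (ha : 0 < a) (hb : 0 < b) :
    ∫ t in Ioi (0:ℝ), t ^ (-(3 / 2) : ℝ) * ker a b t
      = Real.sqrt Real.pi / b * Real.exp (-(2 * a * b)) := by
  set g : ℝ → ℝ := fun t => Real.exp (-(2 * a * b)) * Phi (a * Real.sqrt t - b / Real.sqrt t)
    - Real.exp (2 * a * b) * Phi (a * Real.sqrt t + b / Real.sqrt t) with hg
  have hs0 : Tendsto (fun t : ℝ => Real.sqrt t) (𝓝[>] 0) (𝓝[>] 0) := by
    refine tendsto_nhdsWithin_iff.2 ⟨?_, ?_⟩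
    · have := Real.continuous_sqrt.tendsto 0
      rw [Real.sqrt_zero] at this
      exact this.mono_left nhdsWithin_le_nhds
    · filter_upwards [self_mem_nhdsWithin] with t ht using Real.sqrt_pos.2 ht
  have hb0 : Tendsto (fun t : ℝ => b / Real.sqrt t) (𝓝[>] 0) atTop := by
    simpa [div_eq_mul_inv] using (tendsto_inv_nhdsGT_zero.comp hs0).const_mul_atTop hb
  have ha0 : Tendsto (fun t : ℝ => a * Real.sqrt t) (𝓝[>] 0) (𝓝 0) := by
    simpa using (hs0.mono_right nhdsWithin_le_nhds).const_mul a
  have hb1 : Tendsto (fun t : ℝ => b / Real.sqrt t) atTop (𝓝 0) :=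
    Real.tendsto_sqrt_atTop.const_div_atTop b
  have ha1 : Tendsto (fun t : ℝ => a * Real.sqrt t) atTop atTop :=
    Real.tendsto_sqrt_atTop.const_mul_atTop ha
  have h0 : Tendsto g (𝓝[>] 0) (𝓝 (Real.exp (-(2 * a * b)) * 0 - Real.exp (2 * a * b) * Real.sqrt Real.pi)) := by
    refine ((Phi_bot.comp ?_).const_mul _).sub ((Phi_top.comp ?_).const_mul _)
    · simpa [sub_eq_add_neg] using ha0.add_atBot (tendsto_neg_atTop_atBot.comp hb0)
    · exact ha0.add_atTop hb0
  have h1 : Tendsto g atTop (𝓝 (Real.exp (-(2 * a * b)) * Real.sqrt Real.pi - Real.exp (2 * a * b) * Real.sqrt Real.pi)) := by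
    refine ((Phi_top.comp ?_).const_mul _).sub ((Phi_top.comp ?_).const_mul _)
    · simpa [sub_eq_add_neg] using ha1.atTop_add hb1.neg
    · exact ha1.atTop_add hb1
  have hd : ∀ t ∈ Ioi (0:ℝ), HasDerivAt g (b * (t ^ (-(3 / 2) : ℝ) * ker a b t)) t := by
    intro t ht
    have ht' : 0 < t := ht
    have hsq : 0 < Real.sqrt t := Real.sqrt_pos.2 ht'
    have d1 := Real.hasDerivAt_sqrt ht'.ne'
    have d2 := (d1.const_mul a).sub ((hasDerivAt_const t b).div d1 hsq.ne')
    have d3 := (d1.const_mul a).add ((hasDerivAt_const t b).div d1 hsq.ne')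
    have d4 := ((Phi_hasDerivAt _).comp t d2).const_mul (Real.exp (-(2 * a * b)))
    have d5 := ((Phi_hasDerivAt _).comp t d3).const_mul (Real.exp (2 * a * b))
    have d6 := d4.sub d5
    refine HasDerivAt.congr_deriv d6 ?_
    have hst : Real.sqrt t ^ 2 = t := Real.sq_sqrt ht'.le
    have e1 : Real.exp (-(2 * a * b)) * Real.exp (-(a * Real.sqrt t - b / Real.sqrt t) ^ 2) = ker a b t := by
      rw [← Real.exp_add, ker]; congr 1
      field_simp
      rw [hst]; ring_nf
    have e2 : Real.exp (2 * a * b) * Real.exp (-(a * Real.sqrt t + b / Real.sqrt t) ^ 2) = ker a b t := by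
      rw [← Real.exp_add, ker]; congr 1
      field_simp
      rw [hst]; ring_nf
    have e3 : t ^ (-(3 / 2) : ℝ) = 1 / (Real.sqrt t ^ 3) := by
      rw [Real.sqrt_eq_rpow, ← Real.rpow_natCast, ← Real.rpow_mul ht'.le, one_div, ← Real.rpow_neg ht'.le]
      norm_num
    simp only [Pi.sub_apply, Pi.add_apply, Pi.div_apply, Pi.mul_apply] at *
    rw [← mul_assoc, ← mul_assoc, e1, e2, e3]
    field_simp
    ring
  set G := Function.update g 0 (Real.exp (-(2 * a * b)) * 0 - Real.exp (2 * a * b) * Real.sqrt Real.pi) with hG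
  have key := integral_Ioi_of_hasDerivAt_of_nonneg (g := G) (a := 0)
    (g' := fun t => b * (t ^ (-(3 / 2) : ℝ) * ker a b t))
    (l := (Real.exp (-(2 * a * b)) * Real.sqrt Real.pi - Real.exp (2 * a * b) * Real.sqrt Real.pi))
    (by
      rw [hG]
      refine continuousWithinAt_update_same.mpr ?_
      rwa [Ici_sdiff_left])
    (fun t ht => (hd t ht).congr_of_eventuallyEq (by
      filter_upwards [lt_mem_nhds (show (0:ℝ) < t from ht)] with u hu
      rw [hG, Function.update_of_ne hu.ne']))
    (fun t ht => by
      have : (0:ℝ) < t := ht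
      unfold ker
      positivity)
    (h1.congr' (by
      filter_upwards [eventually_gt_atTop 0] with u hu
      rw [hG, Function.update_of_ne hu.ne']))
  rw [integral_const_mul] at key
  have hG0 : G 0 = Real.exp (-(2 * a * b)) * 0 - Real.exp (2 * a * b) * Real.sqrt Real.pi := by simp [hG]
  rw [hG0] at key
  have e : Real.sqrt Real.pi / b * Real.exp (-(2 * a * b)) = (Real.exp (-(2 * a * b)) * Real.sqrt Real.pi) / b := by ring
  rw [e, eq_div_iff hb.ne']
  linarith

end CSF
end

section
open Filter Topology Asymptotics Set MeasureTheory

namespace CSF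

lemma ker_pos (a b t : ℝ) : 0 < ker a b t := Real.exp_pos _

lemma ker_contOn (a b : ℝ) : ContinuousOn (fun t => ((ker a b t : ℝ) : ℂ)) (Ioi 0) := by
  refine Complex.continuous_ofReal.comp_continuousOn ?_
  unfold ker
  refine Real.continuous_exp.comp_continuousOn (ContinuousOn.neg (ContinuousOn.add (by fun_prop) ?_))
  exact continuousOn_const.div continuousOn_id (fun t ht => (ne_of_gt ht))

lemma ker_bigO_top {a : ℝ} (b : ℝ) :
    (fun t => ((ker a b t : ℝ) : ℂ)) =O[atTop] fun t => Real.exp (-(a ^ 2) * t) := by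
  refine IsBigO.of_bound 1 ?_
  filter_upwards [eventually_gt_atTop 0] with t ht
  rw [Complex.norm_real, one_mul, Real.norm_of_nonneg (ker_pos _ _ _).le,
    Real.norm_of_nonneg (Real.exp_pos _).le, ker, Real.exp_le_exp]
  have : 0 ≤ b ^ 2 / t := by positivity
  linarith

lemma ker_bigO_zero (a : ℝ) {b : ℝ} (hb : 0 < b) (c : ℝ) :
    (fun t => ((ker a b t : ℝ) : ℂ)) =O[𝓝[>] 0] fun t => t ^ (-c) := by
  have h1 := (isLittleO_exp_neg_mul_rpow_atTop (a := b ^ 2) (by positivity) c).isBigO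
  have h2 := h1.comp_tendsto (tendsto_inv_nhdsGT_zero (𝕜 := ℝ))
  refine IsBigO.trans (IsBigO.of_bound 1 ?_) (h2.trans (IsBigO.of_bound 1 ?_))
  · filter_upwards [self_mem_nhdsWithin] with t ht
    have ht : 0 < t := ht
    simp only [Function.comp]
    rw [Complex.norm_real, one_mul, Real.norm_of_nonneg (ker_pos _ _ _).le,
      Real.norm_of_nonneg (Real.exp_pos _).le, ker, Real.exp_le_exp, neg_mul, neg_le_neg_iff]
    have : 0 ≤ a ^ 2 * t := by positivity
    rw [div_eq_mul_inv]
    linarith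
  · filter_upwards [self_mem_nhdsWithin] with t ht
    have ht : 0 < t := ht
    simp only [Function.comp]
    rw [Real.inv_rpow ht.le, Real.rpow_neg ht.le, one_mul]

lemma ker_locInt (a b : ℝ) : LocallyIntegrableOn (fun t => ((ker a b t : ℝ) : ℂ)) (Ioi 0) :=
  (ker_contOn a b).locallyIntegrableOn measurableSet_Ioi

lemma ker_conv {a b : ℝ} (ha : 0 < a) (hb : 0 < b) (s : ℂ) :
    MellinConvergent (fun t => ((ker a b t : ℝ) : ℂ)) s :=
  mellinConvergent_of_isBigO_rpow_exp (a := a ^ 2) (b := s.re - 1) (by positivity)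
    (ker_locInt a b) (ker_bigO_top b) (ker_bigO_zero a hb _) (by linarith)

lemma ker_diff {a b : ℝ} (ha : 0 < a) (hb : 0 < b) :
    Differentiable ℂ (mellin (fun t => ((ker a b t : ℝ) : ℂ))) := fun s =>
  mellin_differentiableAt_of_isBigO_rpow_exp (a := a ^ 2) (b := s.re - 1) (by positivity)
    (ker_locInt a b) (ker_bigO_top b) (ker_bigO_zero a hb _) (by linarith)

lemma ker_le {a b a0 b0 t : ℝ} (ha0 : 0 < a0) (hb0 : 0 < b0) (ha : a0 ≤ a) (hb : b0 ≤ b)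
    (ht : 0 < t) : ker a b t ≤ Real.exp (-(a * b)) * ker (a0 / 2) (b0 / 2) t := by
  unfold ker
  rw [← Real.exp_add, Real.exp_le_exp]
  have e1 : a0 ^ 2 ≤ a ^ 2 := by gcongr
  have e2 : b0 ^ 2 ≤ b ^ 2 := by gcongr
  have e3 : a * b ≤ (a ^ 2 * t + b ^ 2 / t) / 2 := by
    have : 0 ≤ (a * t - b) ^ 2 / t := by positivity
    have e : (a * t - b) ^ 2 / t = a ^ 2 * t + b ^ 2 / t - 2 * (a * b) := by
      field_simp
      ring
    linarith
  have e4 : a0 ^ 2 * t ≤ a ^ 2 * t := by gcongr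
  have e5 : b0 ^ 2 / t ≤ b ^ 2 / t := by gcongr
  have e6 : (b0 / 2) ^ 2 / t = (b0 ^ 2 / t) / 4 := by ring
  have e7 : 0 ≤ a0 ^ 2 * t := by positivity
  have e8 : 0 ≤ b0 ^ 2 / t := by positivity
  rw [e6]
  nlinarith

lemma norm_integrand (a b : ℝ) (s : ℂ) {t : ℝ} (ht : 0 < t) :
    ‖(t : ℂ) ^ (s - 1) • ((ker a b t : ℝ) : ℂ)‖ = t ^ (s.re - 1) * ker a b t := by
  rw [norm_smul, Complex.norm_cpow_eq_rpow_re_of_pos ht, Complex.norm_real,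
    Real.norm_of_nonneg (ker_pos _ _ _).le]
  simp

lemma ker_conv_real {a b : ℝ} (ha : 0 < a) (hb : 0 < b) (σ : ℝ) :
    IntegrableOn (fun t => t ^ (σ - 1) * ker a b t) (Ioi 0) := by
  have := (ker_conv ha hb (σ : ℂ)).norm
  refine IntegrableOn.congr_fun this (fun t ht => ?_) measurableSet_Ioi
  simpa using norm_integrand a b (σ : ℂ) ht

lemma ker_int_bound (R : ℝ) {a0 b0 : ℝ} (ha0 : 0 < a0) (hb0 : 0 < b0) :
    ∃ C : ℝ, ∀ a b : ℝ, a0 ≤ a → b0 ≤ b → ∀ s : ℂ, |s.re| ≤ R →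
      ∫ t in Ioi (0:ℝ), ‖(t : ℂ) ^ (s - 1) • ((ker a b t : ℝ) : ℂ)‖ ≤ C * Real.exp (-(a * b)) := by
  refine ⟨∫ t in Ioi (0:ℝ), (t ^ (R - 1) * ker (a0 / 2) (b0 / 2) t + t ^ (-R - 1) * ker (a0 / 2) (b0 / 2) t), ?_⟩
  intro a b ha hb s hs
  rw [mul_comm, ← integral_const_mul]
  have i1 := (ker_conv_real (half_pos ha0) (half_pos hb0) R).add (ker_conv_real (half_pos ha0) (half_pos hb0) (-R))
  refine setIntegral_mono_on (ker_conv (ha0.trans_le ha) (hb0.trans_le hb) s).norm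
    (i1.const_mul (Real.exp (-(a * b)))) measurableSet_Ioi ?_
  intro t ht
  have ht : 0 < t := ht
  rw [norm_integrand a b s ht]
  have h1 := ker_le ha0 hb0 ha hb ht
  obtain ⟨h2, h3⟩ := abs_le.1 hs
  have h4 : t ^ (s.re - 1) ≤ t ^ (R - 1) + t ^ (-R - 1) := by
    rcases le_total t 1 with h | h
    · have := Real.rpow_le_rpow_of_exponent_ge ht h (show -R - 1 ≤ s.re - 1 by linarith)
      have : 0 ≤ t ^ (R - 1) := by positivity
      linarith
    · have := Real.rpow_le_rpow_of_exponent_le h (show s.re - 1 ≤ R - 1 by linarith)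
      have : 0 ≤ t ^ (-R - 1) := by positivity
      linarith
  calc t ^ (s.re - 1) * ker a b t ≤ (t ^ (R - 1) + t ^ (-R - 1)) * (Real.exp (-(a * b)) * ker (a0 / 2) (b0 / 2) t) := by
        gcongr
        exact (ker_pos _ _ _).le
    _ = _ := by ring

lemma ker_mellin_bound (R : ℝ) {a0 b0 : ℝ} (ha0 : 0 < a0) (hb0 : 0 < b0) :
    ∃ C : ℝ, ∀ a b : ℝ, a0 ≤ a → b0 ≤ b → ∀ s : ℂ, |s.re| ≤ R →
      ‖mellin (fun t => ((ker a b t : ℝ) : ℂ)) s‖ ≤ C * Real.exp (-(a * b)) := by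
  obtain ⟨C, hC⟩ := ker_int_bound R ha0 hb0
  exact ⟨C, fun a b ha hb s hs => (norm_integral_le_integral_norm _).trans (hC a b ha hb s hs)⟩

lemma ker_zero_mellin {a : ℝ} (ha : 0 < a) {s : ℂ} (hs : 0 < s.re) :
    mellin (fun t => ((ker a 0 t : ℝ) : ℂ)) s = Complex.Gamma s * (a : ℂ) ^ (-2 * s) := by
  have h := Complex.integral_cpow_mul_exp_neg_mul_Ioi hs (r := a ^ 2) (by positivity)
  have e : mellin (fun t => ((ker a 0 t : ℝ) : ℂ)) s = ∫ t : ℝ in Ioi 0, (t : ℂ) ^ (s - 1) * Complex.exp (-(((a ^ 2 : ℝ) : ℂ) * t)) := by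
    unfold mellin ker
    refine setIntegral_congr_fun measurableSet_Ioi (fun t ht => ?_)
    simp
  rw [e]
  rw [h, mul_comm]
  congr 1
  rw [one_div, ← Complex.ofReal_inv, Complex.cpow_def_of_ne_zero (by exact_mod_cast (by positivity : (a^2)⁻¹ ≠ 0)),
    Complex.cpow_def_of_ne_zero (by exact_mod_cast ha.ne'), ← Complex.ofReal_log (by positivity), ← Complex.ofReal_log ha.le,
    Real.log_inv, Real.log_pow]
  congr 1
  push_cast
  ring

lemma ker_zero_conv {a : ℝ} (ha : 0 < a) {s : ℂ} (hs : 0 < s.re) :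
    MellinConvergent (fun t => ((ker a 0 t : ℝ) : ℂ)) s := by
  refine mellinConvergent_of_isBigO_rpow_exp (a := a ^ 2) (b := 0) (by positivity)
    (ker_locInt a 0) (ker_bigO_top 0) ?_ hs
  refine IsBigO.of_bound 1 ?_
  filter_upwards [self_mem_nhdsWithin] with t ht
  have ht : 0 < t := ht
  rw [Complex.norm_real, one_mul, Real.norm_of_nonneg (ker_pos _ _ _).le, ker, neg_zero, Real.rpow_zero,
    norm_one, Real.exp_le_one_iff]
  have : 0 ≤ a ^ 2 * t := by positivity
  simpa using this

lemma ker_mellin_neg_half {a b : ℝ} (ha : 0 < a) (hb : 0 < b) :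
    mellin (fun t => ((ker a b t : ℝ) : ℂ)) (-(1 / 2)) =
      ((Real.sqrt Real.pi / b * Real.exp (-(2 * a * b)) : ℝ) : ℂ) := by
  rw [← bessel_half ha hb, ← integral_complex_ofReal]
  unfold mellin
  refine setIntegral_congr_fun measurableSet_Ioi (fun t ht => ?_)
  have ht : 0 < t := ht
  rw [smul_eq_mul, Complex.ofReal_mul, Complex.ofReal_cpow ht.le]
  norm_num

end CSF
end

section
open Filter Topology Asymptotics Set MeasureTheory

namespace CSF

lemma summable_gauss (x : ℝ) {t : ℝ} (ht : 0 < t) :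
    Summable (fun n : ℤ => Real.exp (-((n + x) ^ 2) * t)) := by
  have h := (summable_jacobiTheta₂_term_iff (Complex.I * (x * t / Real.pi)) (Complex.I * (t / Real.pi))).2 (by
    have : (Complex.I * ((t : ℂ) / Real.pi)).im = t / Real.pi := by
      rw [← Complex.ofReal_div]; simp
    rw [this]; positivity)
  have h2 := (h.norm).mul_left (Real.exp (-(x ^ 2) * t))
  refine h2.congr (fun n => ?_)
  have e : jacobiTheta₂_term n (Complex.I * (x * t / Real.pi)) (Complex.I * (t / Real.pi)) =
      ((Real.exp (-2 * n * x * t - n ^ 2 * t) : ℝ) : ℂ) := by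
    rw [jacobiTheta₂_term, Complex.ofReal_exp]
    congr 1
    have : (Real.pi : ℂ) ≠ 0 := by exact_mod_cast Real.pi_ne_zero
    push_cast
    field_simp
    simp only [Complex.I_sq]
    ring
  rw [e, Complex.norm_real, Real.norm_of_nonneg (Real.exp_pos _).le, ← Real.exp_add]
  congr 1
  ring

/-- the additive character -/
noncomputable def ec (r : ℝ) : ℂ := Complex.exp (-(2 * Real.pi * r * Complex.I))

lemma norm_ec (r : ℝ) : ‖ec r‖ = 1 := by
  have : ec r = Complex.exp (((-(2 * Real.pi * r) : ℝ) : ℂ) * Complex.I) := by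
    rw [ec]; congr 1; push_cast; ring
  rw [this, Complex.norm_exp_ofReal_mul_I]

lemma poisson (x c : ℝ) {t : ℝ} (ht : 0 < t) :
    ∑' n : ℤ, (1 : ℂ) * ((Real.exp (-((n + x) ^ 2 + c ^ 2) * t) : ℝ) : ℂ) =
      ((Real.sqrt Real.pi : ℝ) : ℂ) * (t : ℂ) ^ (-(1 / 2) : ℂ) *
        ∑' k : ℤ, ec (k * x) * ((ker c (Real.pi * k) t : ℝ) : ℂ) := by
  have hp : (0:ℝ) < Real.pi / t := by positivity
  have hpi : (Real.pi : ℂ) ≠ 0 := by exact_mod_cast Real.pi_ne_zero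
  have htc : (t : ℂ) ≠ 0 := by exact_mod_cast ht.ne'
  have h := Complex.tsum_exp_neg_quadratic (a := ((Real.pi / t : ℝ) : ℂ)) (by rw [Complex.ofReal_re]; exact hp)
    (-(Complex.I * x))
  have e1 : ∀ n : ℤ, (1:ℂ) * ((Real.exp (-((n + x) ^ 2 + c ^ 2) * t) : ℝ) : ℂ) =
      Complex.exp (-(c ^ 2 * t)) * Complex.exp (-Real.pi / ((Real.pi / t : ℝ) : ℂ) * (n + Complex.I * (-(Complex.I * x))) ^ 2) := by
    intro n
    rw [one_mul, Complex.ofReal_exp, ← Complex.exp_add]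
    congr 1
    rw [show Complex.I * (-(Complex.I * x)) = x by rw [mul_neg, ← mul_assoc, Complex.I_mul_I]; ring]
    push_cast
    field_simp
    ring
  have e2 : ∀ k : ℤ, ec (k * x) * ((ker c (Real.pi * k) t : ℝ) : ℂ) =
      Complex.exp (-(c ^ 2 * t)) * Complex.exp (-Real.pi * ((Real.pi / t : ℝ) : ℂ) * k ^ 2 + 2 * Real.pi * (-(Complex.I * x)) * k) := by
    intro k
    rw [ec, ker, Complex.ofReal_exp, ← Complex.exp_add, ← Complex.exp_add]
    congr 1
    push_cast
    field_simp
    ring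
  simp_rw [e1, e2, tsum_mul_left]
  rw [h]
  have e3 : ((Real.sqrt Real.pi : ℝ) : ℂ) * (t : ℂ) ^ (-(1 / 2) : ℂ) = ((Real.pi / t : ℝ) : ℂ) ^ (1 / 2 : ℂ) := by
    rw [Real.sqrt_eq_rpow, Complex.ofReal_cpow Real.pi_pos.le, div_eq_mul_inv Real.pi t, Complex.ofReal_mul,
      Complex.mul_cpow_ofReal_nonneg Real.pi_pos.le (by positivity), Complex.ofReal_inv,
      Complex.cpow_neg, Complex.inv_cpow]
    · push_cast; rfl
    · rw [Complex.arg_ofReal_of_nonneg ht.le]; exact Real.pi_pos.ne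
  have hne : ((Real.pi / t : ℝ) : ℂ) ^ (1 / 2 : ℂ) ≠ 0 := by
    rw [Ne, Complex.cpow_eq_zero_iff, not_and_or]
    left; exact_mod_cast hp.ne'
  rw [e3]
  generalize hA : ((Real.pi / t : ℝ) : ℂ) ^ (1 / 2 : ℂ) = A at *
  field_simp

lemma summable_exp_int {r : ℝ} (hr : 0 < r) : Summable (fun k : ℤ => Real.exp (-(r * |(k:ℝ)|))) := by
  have h : Summable (fun k : ℕ => Real.exp (-(r * k))) := by
    have := Real.summable_exp_nat_mul_iff.2 (neg_lt_zero.2 hr)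
    refine this.congr (fun n => ?_)
    congr 1; ring
  refine Summable.of_nat_of_neg ?_ ?_
  · simpa using h
  · simpa using h

lemma ker_even (a b : ℝ) : ker a (-b) = ker a b := by
  funext t; simp [ker]

lemma ker_abs (a b : ℝ) : ker a |b| = ker a b := by
  funext t; simp [ker]

lemma row_hasSum {x c : ℝ} (hc : 0 < c) {s : ℂ} (hs : 1 / 2 < s.re)
    (hsum : Summable fun n : ℤ => 1 / ((n + x) ^ 2 + c ^ 2) ^ s.re) :
    ∃ M : ℂ, HasSum (fun n : ℤ => Complex.Gamma s * ((((n + x) ^ 2 + c ^ 2 : ℝ)) : ℂ) ^ (-s)) M ∧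
      HasSum (fun k : ℤ => ((Real.sqrt Real.pi : ℝ) : ℂ) * (ec (k * x) *
        mellin (fun t => ((ker c (Real.pi * k) t : ℝ) : ℂ)) (s - 1 / 2))) M := by
  set F : ℝ → ℂ := fun t => ∑' n : ℤ, (1 : ℂ) * ((Real.exp (-((n + x) ^ 2 + c ^ 2) * t) : ℝ) : ℂ) with hF
  refine ⟨mellin F s, ?_, ?_⟩
  · have := hasSum_mellin (ι := ℤ) (a := fun _ => 1) (p := fun n => ((n + x) ^ 2 + c ^ 2 : ℝ)) (F := F) (s := s)
      (fun n => Or.inr (by positivity)) (by linarith) (fun t ht => ?_) (by simpa using hsum)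
    · refine HasSum.congr_fun this (fun n => ?_)
      rw [mul_one, Complex.cpow_neg, div_eq_mul_inv]
    · apply Summable.hasSum
      have h1 := (summable_gauss x (show 0 < t from ht)).mul_left (Real.exp (-(c ^ 2) * t))
      have h2 := (Complex.ofRealCLM.summable h1)
      refine h2.congr (fun n => ?_)
      simp only [Complex.ofRealCLM_apply, one_mul]
      rw [← Real.exp_add]
      congr 2
      ring
  · have hs' : 0 < (s - 1 / 2).re := by simp; linarith
    have hInteg : ∀ k : ℤ, IntegrableOn (fun t : ℝ => (t : ℂ) ^ (s - 1 / 2 - 1) • ((ker c (Real.pi * k) t : ℝ) : ℂ)) (Ioi 0) := by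
      intro k
      by_cases hk : k = 0
      · subst hk
        simpa [MellinConvergent] using ker_zero_conv hc hs'
      · rw [← ker_abs]
        refine ker_conv hc ?_ _
        have : (k:ℝ) ≠ 0 := by exact_mod_cast hk
        positivity
    obtain ⟨C, hC⟩ := ker_int_bound |(s - 1 / 2).re| hc Real.pi_pos
    have key := hasSum_integral_of_summable_integral_norm (μ := volume.restrict (Ioi (0:ℝ)))
      (F := fun (k : ℤ) (t : ℝ) => (((Real.sqrt Real.pi : ℝ) : ℂ) * ec (k * x)) • ((t : ℂ) ^ (s - 1 / 2 - 1) • ((ker c (Real.pi * k) t : ℝ) : ℂ)))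
      (fun k => Integrable.smul (c := ((Real.sqrt Real.pi : ℝ) : ℂ) * ec (k * x)) (hInteg k)) (by
        simp_rw [norm_smul (((Real.sqrt Real.pi : ℝ) : ℂ) * _), norm_mul, norm_ec, mul_one]
        simp_rw [integral_const_mul]
        refine Summable.mul_left _ ?_
        refine Summable.of_norm_bounded_eventually (g := fun k : ℤ => C * Real.exp (-(c * Real.pi * |(k:ℝ)|)))
          ((summable_exp_int (by positivity)).mul_left C) ?_
        rw [Filter.eventually_cofinite]
        refine (Set.finite_singleton (0:ℤ)).subset (fun k hk => ?_)
        by_contra hk0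
        refine hk ?_
        have hk1 : (1:ℝ) ≤ |(k:ℝ)| := by
          have := Int.one_le_abs (show k ≠ 0 from hk0)
          exact_mod_cast this
        have := hC c |Real.pi * k| le_rfl (by
          rw [abs_mul, abs_of_pos Real.pi_pos]
          nlinarith [Real.pi_pos]) (s - 1 / 2) le_rfl
        rw [ker_abs] at this
        rw [Real.norm_of_nonneg (integral_nonneg (fun _ => by positivity))]
        rw [abs_mul, abs_of_pos Real.pi_pos] at this
        simpa [mul_assoc] using this)
    have e1 : mellin F s = ∫ t in Ioi (0:ℝ), ∑' k : ℤ, (((Real.sqrt Real.pi : ℝ) : ℂ) * ec (k * x)) • ((t : ℂ) ^ (s - 1 / 2 - 1) • ((ker c (Real.pi * k) t : ℝ) : ℂ)) := by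
      unfold mellin
      refine setIntegral_congr_fun measurableSet_Ioi (fun t ht => ?_)
      have ht : 0 < t := ht
      have htc : (t : ℂ) ≠ 0 := by exact_mod_cast ht.ne'
      simp only [hF, smul_eq_mul]
      rw [poisson x c ht, ← tsum_mul_left, ← tsum_mul_left]
      congr 1
      funext k
      rw [show s - 1 / 2 - 1 = (s - 1) + (-(1 / 2)) by ring, Complex.cpow_add _ _ htc]
      ring
    rw [e1]
    refine HasSum.congr_fun key (fun k => ?_)
    rw [integral_smul, smul_eq_mul, mul_assoc]
    rfl

end CSF
end

section
open Filter Topology Asymptotics Set MeasureTheory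

namespace CSF

/-- the terms of the rapidly convergent double series -/
noncomputable def Ht (x y : ℝ) (p : ℕ × ℕ) (s : ℂ) : ℂ :=
  ((2 * Real.cos (2 * Real.pi * ((p.2 + 1) * ((p.1 + 1) * x))) : ℝ) : ℂ) *
    mellin (fun t => ((ker ((p.1 + 1) * y) (Real.pi * (p.2 + 1)) t : ℝ) : ℂ)) (s - 1 / 2)

noncomputable def HH (x y : ℝ) (s : ℂ) : ℂ := ∑' p : ℕ × ℕ, Ht x y p s

lemma Ht_sum_bound {r : ℝ} (hr : 0 < r) :
    Summable (fun p : ℕ × ℕ => Real.exp (-(r * ((p.1 + 1) * (p.2 + 1))))) := by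
  have h1 : Summable (fun k : ℕ => Real.exp (-(r / 2 * k))) := by
    have := Real.summable_exp_nat_mul_of_ge (c := -(r/2)) (by linarith) (f := fun k : ℕ => (k : ℝ)) (fun k => le_rfl)
    exact this.congr fun k => by ring_nf
  have h2 := h1.mul_of_nonneg h1 (fun _ => (Real.exp_pos _).le) (fun _ => (Real.exp_pos _).le)
  refine Summable.of_nonneg_of_le (fun _ => (Real.exp_pos _).le) (fun p => ?_) h2
  simp only [← Real.exp_add]
  apply Real.exp_le_exp.2
  have a : (0:ℝ) ≤ p.1 := by positivity
  have b : (0:ℝ) ≤ p.2 := by positivity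
  nlinarith [mul_nonneg a b, mul_nonneg hr.le (mul_nonneg a b), mul_nonneg hr.le a, mul_nonneg hr.le b]

lemma Ht_bound (x : ℝ) {y : ℝ} (hy : 0 < y) (R : ℝ) :
    ∃ u : ℕ × ℕ → ℝ, Summable u ∧ ∀ p s, |(s - 1/2 : ℂ).re| ≤ R → ‖Ht x y p s‖ ≤ u p := by
  obtain ⟨C, hC⟩ := ker_mellin_bound R hy Real.pi_pos
  refine ⟨fun p => 2 * (C * Real.exp (-(y * Real.pi * ((p.1 + 1) * (p.2 + 1))))), ?_, ?_⟩
  · exact ((Ht_sum_bound (by positivity)).mul_left C).mul_left 2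
  · intro p s hs
    rw [Ht, norm_mul]
    refine mul_le_mul ?_ ?_ (norm_nonneg _) (by norm_num)
    · rw [Complex.norm_real, Real.norm_eq_abs, abs_mul, abs_two]
      have := Real.abs_cos_le_one (2 * Real.pi * ((p.2 + 1) * ((p.1 + 1) * x)))
      linarith
    · refine (hC ((p.1 + 1) * y) (Real.pi * (p.2 + 1)) ?_ ?_ _ hs).trans (le_of_eq ?_)
      · nlinarith [mul_nonneg (Nat.cast_nonneg (α := ℝ) p.1) hy.le]
      · nlinarith [mul_nonneg (Nat.cast_nonneg (α := ℝ) p.2) Real.pi_pos.le]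
      · ring_nf

lemma Ht_summable (x : ℝ) {y : ℝ} (hy : 0 < y) (s : ℂ) : Summable fun p => Ht x y p s := by
  obtain ⟨u, hu, h⟩ := Ht_bound x hy |(s - 1/2 : ℂ).re|
  exact Summable.of_norm_bounded hu fun p => h p s le_rfl

lemma Ht_diff (x : ℝ) {y : ℝ} (hy : 0 < y) (p : ℕ × ℕ) : Differentiable ℂ (Ht x y p) := by
  have h := ker_diff (a := (p.1 + 1) * y) (b := Real.pi * (p.2 + 1)) (by positivity) (by positivity)
  unfold Ht
  exact (differentiable_const _).mul (h.comp (differentiable_id.sub_const _))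

lemma HH_diff (x : ℝ) {y : ℝ} (hy : 0 < y) : Differentiable ℂ (HH x y) := by
  intro s
  set R := |(s - 1/2 : ℂ).re| + 1
  obtain ⟨u, hu, h⟩ := Ht_bound x hy R
  have ho : IsOpen {s : ℂ | |(s - 1/2 : ℂ).re| < R} :=
    isOpen_lt (by fun_prop) continuous_const
  have := Complex.differentiableOn_tsum_of_summable_norm hu (F := fun p s => Ht x y p s) (fun p => (Ht_diff x hy p).differentiableOn) ho
    (fun p w hw => h p w (le_of_lt hw))
  exact this.differentiableAt (ho.mem_nhds (by simp [R]))

lemma ec_add (r : ℝ) : ec r + ec (-r) = ((2 * Real.cos (2 * Real.pi * r) : ℝ) : ℂ) := by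
  unfold ec
  push_cast
  rw [Complex.two_cos]
  ring_nf

/-- one row -/
lemma row_split {x c : ℝ} (hc : 0 < c) {s : ℂ} (hs : 1 / 2 < s.re)
    (hsum : Summable fun n : ℤ => 1 / ((n + x) ^ 2 + c ^ 2) ^ s.re) :
    ∃ M, HasSum (fun n : ℤ => Complex.Gamma s * ((((n + x) ^ 2 + c ^ 2 : ℝ)) : ℂ) ^ (-s))
      (((√Real.pi : ℝ) : ℂ) * (Complex.Gamma (s - 1/2) * (c : ℂ) ^ (1 - 2 * s) + M)) ∧
      HasSum (fun k : ℕ => ((2 * Real.cos (2 * Real.pi * ((k + 1) * x)) : ℝ) : ℂ) *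
        mellin (fun t => ((ker c (Real.pi * (k + 1)) t : ℝ) : ℂ)) (s - 1 / 2)) M := by
  obtain ⟨M, h1, h2⟩ := row_hasSum hc hs hsum
  have hpi : ((√Real.pi : ℝ) : ℂ) ≠ 0 := by
    exact_mod_cast (Real.sqrt_pos.2 Real.pi_pos).ne'
  have h3 := (hasSum_mul_left_iff hpi (a₁ := M / ((√Real.pi : ℝ) : ℂ))).1 (by rwa [mul_div_cancel₀ _ hpi])
  have h4 := (hasSum_nat_add_iff' 1).2 h3.nat_add_neg
  simp only [Finset.range_one, Finset.sum_singleton] at h4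
  have h0 : (ec (((0 : ℤ) : ℝ) * x) * mellin (fun t => ((ker c (Real.pi * ((0:ℤ) : ℝ)) t : ℝ) : ℂ)) (s - 1/2)) =
      Complex.Gamma (s - 1/2) * (c : ℂ) ^ (1 - 2 * s) := by
    have e : ec (((0 : ℤ) : ℝ) * x) = 1 := by simp [ec]
    rw [e, one_mul]
    simp only [Int.cast_zero, mul_zero]
    rw [ker_zero_mellin hc (by simp; linarith)]
    congr 2
    ring
  refine ⟨M / ((√Real.pi : ℝ) : ℂ) - Complex.Gamma (s - 1/2) * (c : ℂ) ^ (1 - 2 * s), ?_, ?_⟩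
  · convert h1 using 1
    field_simp
    ring
  · have hv : M / ((√Real.pi : ℝ) : ℂ) - Complex.Gamma (s - 1/2) * (c : ℂ) ^ (1 - 2 * s) = _ :=
      (show _ = M / ((√Real.pi : ℝ) : ℂ) + _ - (_ + _) by
        rw [← h0]
        have : ∀ a b : ℂ, a - b = a + b - (b + b) := fun a b => by ring
        exact this _ _)
    rw [hv]
    refine HasSum.congr_fun h4 fun k => ?_
    have e1 : (((-((k + 1 : ℕ) : ℤ) : ℤ)) : ℝ) = -(k + 1 : ℝ) := by push_cast; ring
    have e2 : ((((k + 1 : ℕ) : ℤ) : ℤ) : ℝ) = (k + 1 : ℝ) := by push_cast; ring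
    rw [e1, e2, ← ec_add, ← neg_mul]
    have : (fun t => ((ker c (Real.pi * (-(k + 1 : ℝ))) t : ℝ) : ℂ)) = (fun t => ((ker c (Real.pi * (k + 1 : ℝ)) t : ℝ) : ℂ)) := by
      funext t; rw [mul_neg]; simp only [ker, neg_sq]
    rw [this]; ring

lemma Q_summable (x : ℝ) {y : ℝ} (hy : 0 < y) {r : ℝ} (hr : 1 < r) :
    Summable fun p : ℤ × ℤ => ((p.2 + p.1 * x) ^ 2 + (p.1 * y) ^ 2 : ℝ) ^ (-r) := by
  let z : UpperHalfPlane := ⟨⟨x, y⟩, hy⟩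
  have h := (EisensteinSeries.summable_one_div_norm_rpow (k := 2 * r) (by linarith)).mul_left ((EisensteinSeries.r z) ^ (-(2 * r)))
  have h2 := Summable.of_nonneg_of_le (fun _ => by positivity) (EisensteinSeries.summand_bound z (k := 2 * r) (by linarith)) h
  rw [← (finTwoArrowEquiv _).symm.summable_iff] at h2
  refine h2.congr fun p => ?_
  simp only [Function.comp, finTwoArrowEquiv_symm_apply, Matrix.cons_val_zero, Matrix.cons_val_one]
  have : ‖((p.1 : ℂ)) * (z : ℂ) + p.2‖ ^ 2 = ((p.2 + p.1 * x) ^ 2 + (p.1 * y) ^ 2 : ℝ) := by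
    rw [← Complex.normSq_eq_norm_sq, Complex.normSq_apply]
    simp [z]
    ring
  rw [← this, ← Real.rpow_natCast, ← Real.rpow_mul (norm_nonneg _)]
  simp

lemma norm_Q_cpow {q : ℝ} (hq : 0 ≤ q) {s : ℂ} (hs : 0 < s.re) : ‖((q : ℝ) : ℂ) ^ (-s)‖ = q ^ (-s.re) := by
  rw [Complex.norm_cpow_eq_rpow_re_of_nonneg hq]
  · simp
  · simp [hs.ne']

/-- zeroth row -/
lemma row_zero {s : ℂ} (hs : 1 < s.re) :
    HasSum (fun n : ℤ => ((((n : ℝ) ^ 2 : ℝ)) : ℂ) ^ (-s)) (2 * riemannZeta (2 * s)) := by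
  have hs' : s ≠ 0 := by rintro rfl; simp at hs; linarith
  have h1 : 1 < (2 * s).re := by simp; linarith
  have hz := zeta_eq_tsum_one_div_nat_add_one_cpow h1
  have hsum : Summable fun n : ℕ => 1 / ((n : ℂ) + 1) ^ (2 * s) := by
    have := (summable_nat_add_iff 1).2 (Complex.summable_one_div_nat_cpow.2 h1)
    simpa using this
  have h2 := hsum.hasSum
  rw [← hz] at h2
  have key : ∀ n : ℕ, ((((n + 1 : ℝ) ^ 2 : ℝ)) : ℂ) ^ (-s) = 1 / ((n : ℂ) + 1) ^ (2 * s) := by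
    intro n
    have hp : (0:ℝ) < n + 1 := by positivity
    rw [one_div, ← Complex.cpow_neg]
    have e : ((n : ℂ) + 1) = (((n + 1 : ℝ)) : ℂ) := by push_cast; rfl
    rw [e, ← Real.rpow_natCast, Complex.ofReal_cpow hp.le, ← Complex.ofReal_cpow hp.le, Complex.ofReal_cpow hp.le,
      ← Complex.cpow_mul]
    · congr 1; push_cast; ring
    · rw [← Complex.ofReal_log hp.le]; simp [Real.pi_pos]
    · rw [← Complex.ofReal_log hp.le]; simp [Real.pi_pos.le]
  have h3 := h2.congr_fun key
  have h4 : HasSum (fun n : ℕ => ((((n : ℤ) : ℝ) ^ 2 : ℝ) : ℂ) ^ (-s)) (riemannZeta (2 * s)) := by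
    have := (hasSum_nat_add_iff (f := (fun n : ℕ => ((((n : ℤ) : ℝ) ^ 2 : ℝ) : ℂ) ^ (-s))) 1 (g := riemannZeta (2 * s))).1 (by
      refine h3.congr_fun fun n => ?_
      simp)
    simpa [Complex.zero_cpow (neg_ne_zero.2 hs')] using this
  have := h4.of_nat_of_neg_add_one (f := (fun n : ℤ => ((((n : ℝ) ^ 2 : ℝ)) : ℂ) ^ (-s))) (m' := riemannZeta (2 * s)) (by
      refine h3.congr_fun fun n => ?_
      congr 2
      push_cast; ring)
  rwa [← two_mul] at this
end CSF
end

section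
open Filter Topology Asymptotics Set MeasureTheory

namespace CSF

lemma row_sum (x : ℝ) {y : ℝ} (hy : 0 < y) {s : ℂ} (hs : 1 < s.re) (m : ℕ) :
    HasSum (fun n : ℤ => Complex.Gamma s * ((((n + (m + 1) * x) ^ 2 + ((m + 1) * y) ^ 2 : ℝ)) : ℂ) ^ (-s))
      (((√Real.pi : ℝ) : ℂ) * (Complex.Gamma (s - 1/2) * (((m + 1) * y : ℝ) : ℂ) ^ (1 - 2 * s) +
        ∑' k, Ht x y (m, k) s)) := by
  have hsum : Summable fun n : ℤ => 1 / ((n + (m + 1) * x) ^ 2 + ((m + 1) * y) ^ 2) ^ s.re := by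
    have h := (Q_summable x hy hs).comp_injective (i := fun n : ℤ => (((m + 1 : ℕ) : ℤ), n)) (fun a b h => by simpa using h)
    refine h.congr fun n => ?_
    simp only [Function.comp]
    rw [Real.rpow_neg (by positivity), one_div]
    push_cast
    rfl
  obtain ⟨M, h1, h2⟩ := row_split (x := (m + 1) * x) (c := (m + 1) * y) (by positivity) (by linarith) hsum
  have : ∑' k, Ht x y (m, k) s = M := by
    rw [← h2.tsum_eq]; rfl
  rw [this]; exact h1

lemma Ht_neg (x y : ℝ) (p : ℕ × ℕ) (s : ℂ) : Ht (-x) y p s = Ht x y p s := by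
  unfold Ht
  congr 3
  rw [← Real.cos_neg]; congr 1; ring

lemma full_sum (x : ℝ) {y : ℝ} (hy : 0 < y) {s : ℂ} (hs : 1 < s.re) :
    HasSum (fun p : ℤ × ℤ => Complex.Gamma s * (((p.2 + p.1 * x) ^ 2 + (p.1 * y) ^ 2 : ℝ) : ℂ) ^ (-s))
      (Complex.Gamma s * (2 * riemannZeta (2 * s)) + 2 * (((√Real.pi : ℝ) : ℂ) *
        (Complex.Gamma (s - 1/2) * ((y : ℂ) ^ (1 - 2 * s) * riemannZeta (2 * s - 1)) + HH x y s))) := by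
  have hsm : Summable (fun p : ℤ × ℤ => Complex.Gamma s * (((p.2 + p.1 * x) ^ 2 + (p.1 * y) ^ 2 : ℝ) : ℂ) ^ (-s)) := by
    refine Summable.mul_left _ (Summable.of_norm ?_)
    refine (Q_summable x hy hs).congr fun p => ?_
    rw [norm_Q_cpow (by positivity) (by linarith)]
  have hS := hsm.hasSum
  set S := ∑' p : ℤ × ℤ, Complex.Gamma s * (((p.2 + p.1 * x) ^ 2 + (p.1 * y) ^ 2 : ℝ) : ℂ) ^ (-s)
  let R : ℕ → ℂ := fun m => (((√Real.pi : ℝ) : ℂ) * (Complex.Gamma (s - 1/2) * (((m + 1) * y : ℝ) : ℂ) ^ (1 - 2 * s) +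
        ∑' k, Ht x y (m, k) s))
  let RR : ℤ → ℂ := fun m => if m = 0 then Complex.Gamma s * (2 * riemannZeta (2 * s)) else R (m.natAbs - 1)
  have RR0 : RR ((0 : ℕ) : ℤ) = Complex.Gamma s * (2 * riemannZeta (2 * s)) := if_pos rfl
  have RR1 : ∀ m : ℕ, RR ((m + 1 : ℕ) : ℤ) = R m := fun m => by
    simp only [RR]; rw [if_neg (by omega)]; congr 1
  have RR2 : ∀ m : ℕ, RR (-(m + 1 : ℤ)) = R m := fun m => by
    simp only [RR]; rw [if_neg (by omega)]; congr 1
  have hrow : ∀ m : ℤ, HasSum (fun n : ℤ => Complex.Gamma s * (((n + m * x) ^ 2 + (m * y) ^ 2 : ℝ) : ℂ) ^ (-s)) (RR m) := by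
    intro m
    rcases lt_trichotomy m 0 with hm | hm | hm
    · obtain ⟨k, rfl⟩ : ∃ k : ℕ, m = -(k + 1 : ℤ) := ⟨(-m - 1).toNat, by omega⟩
      rw [RR2]
      have := row_sum (-x) hy hs k
      simp only [Ht_neg] at this
      refine this.congr_fun fun n => ?_
      congr 3
      push_cast; ring
    · subst hm
      refine ((row_zero hs).mul_left (Complex.Gamma s)).congr_fun fun n => ?_
      simp
    · obtain ⟨k, rfl⟩ : ∃ k : ℕ, m = ((k + 1 : ℕ) : ℤ) := ⟨(m - 1).toNat, by omega⟩
      rw [RR1]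
      refine (row_sum x hy hs k).congr_fun fun n => ?_
      push_cast; rfl
  have h1 := hS.prod_fiberwise hrow
  -- sum over positive rows
  have hpos : HasSum R (((√Real.pi : ℝ) : ℂ) *
        (Complex.Gamma (s - 1/2) * ((y : ℂ) ^ (1 - 2 * s) * riemannZeta (2 * s - 1)) + HH x y s)) := by
    refine HasSum.mul_left _ (HasSum.add ?_ ?_)
    · have h1 : 1 < (2 * s - 1).re := by simp; linarith
      have hz := zeta_eq_tsum_one_div_nat_add_one_cpow h1
      have hsum : Summable fun n : ℕ => 1 / ((n : ℂ) + 1) ^ (2 * s - 1) := by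
        have := (summable_nat_add_iff 1).2 (Complex.summable_one_div_nat_cpow.2 h1)
        simpa using this
      have h2 := hsum.hasSum
      rw [← hz] at h2
      refine HasSum.mul_left _ ((h2.mul_left ((y : ℂ) ^ (1 - 2 * s))).congr_fun fun n => ?_)
      rw [Complex.ofReal_mul, Complex.mul_cpow_ofReal_nonneg (by positivity) hy.le, one_div, ← Complex.cpow_neg, mul_comm]
      push_cast
      congr 2; ring
    · exact (Ht_summable x hy s).hasSum.prod_fiberwise fun m => ((Ht_summable x hy s).prod_factor m).hasSum
  have h2 : HasSum (fun n : ℕ => RR n) ((((√Real.pi : ℝ) : ℂ) *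
        (Complex.Gamma (s - 1/2) * ((y : ℂ) ^ (1 - 2 * s) * riemannZeta (2 * s - 1)) + HH x y s)) + Complex.Gamma s * (2 * riemannZeta (2 * s))) := by
    have := (hasSum_nat_add_iff (f := (fun n : ℕ => RR n)) 1).1 (hpos.congr_fun fun n => RR1 n)
    rw [Finset.range_one, Finset.sum_singleton, RR0] at this
    exact this
  have h3 := h2.of_nat_of_neg_add_one (hpos.congr_fun (g := fun n : ℕ => RR (-(n + 1))) fun n => RR2 n)
  have := h1.unique h3
  rw [this] at hS
  convert hS using 1
  ring
end CSF
end

section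
open Filter Topology Asymptotics Set MeasureTheory

namespace CSF

lemma HH_zero (x : ℝ) {y : ℝ} (hy : 0 < y) :
    ∃ S : ℝ, (((√Real.pi : ℝ) : ℂ) * HH x y 0 = ((-2 * S : ℝ) : ℂ)) ∧
      Real.log ‖RamanujanDelta ⟨x, y⟩‖ = -2 * Real.pi * y + 24 * S ∧ RamanujanDelta ⟨x, y⟩ ≠ 0 := by
  set τ : ℂ := ⟨x, y⟩ with hτ
  set q : ℂ := Complex.exp (2 * Real.pi * Complex.I * τ) with hq
  have hqn : ‖q‖ = Real.exp (-2 * Real.pi * y) := by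
    rw [hq, Complex.norm_exp]
    congr 1
    simp [hτ]
  have hq1 : ‖q‖ < 1 := by
    rw [hqn, ← Real.exp_zero]; apply Real.exp_lt_exp.2 ; nlinarith [Real.pi_pos, mul_pos Real.pi_pos hy]
  have hqm : ∀ m : ℕ, ‖q ^ (m + 1)‖ < 1 := fun m => by
    rw [norm_pow]; exact pow_lt_one₀ (norm_nonneg _) hq1 (by omega)
  have hne : ∀ m : ℕ, 1 - q ^ (m + 1) ≠ 0 := fun m h => by
    have := hqm m
    rw [← sub_eq_zero.1 h] at this; simp at this
  have hterm : ∀ p : ℕ × ℕ, ((√Real.pi : ℝ) : ℂ) * Ht x y p 0 =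
      ((2 * ((q ^ (p.1 + 1)) ^ (p.2 + 1) / (p.2 + 1)).re : ℝ) : ℂ) := by
    rintro ⟨m, k⟩
    have e0 : (0 - 1 / 2 : ℂ) = -(1/2) := by ring
    have hk : (0:ℝ) < k + 1 := by positivity
    rw [Ht, e0, ker_mellin_neg_half (by positivity) (by positivity)]
    rw [← Complex.ofReal_mul, ← Complex.ofReal_mul]
    congr 1
    have e1 : (q ^ (m + 1)) ^ (k + 1) = Complex.exp (((-(2 * ((m + 1) * y) * (Real.pi * (k + 1))) : ℝ) : ℂ) +
        ((2 * Real.pi * ((k + 1) * ((m + 1) * x)) : ℝ) : ℂ) * Complex.I) := by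
      rw [hq, ← pow_mul, ← Complex.exp_nat_mul]
      congr 1
      have : τ = x + y * Complex.I := by rw [hτ]; exact Complex.mk_eq_add_mul_I x y
      rw [this]
      push_cast
      ring_nf
      rw [Complex.I_sq]
      ring
    have e2 : ((k : ℂ) + 1) = ((k + 1 : ℝ) : ℂ) := by push_cast; rfl
    simp only
    rw [e1, e2, Complex.div_ofReal_re, Complex.exp_re]
    simp only [Complex.add_re, Complex.add_im, Complex.ofReal_re, Complex.ofReal_im, Complex.mul_re, Complex.mul_im, Complex.I_re, Complex.I_im, mul_zero, mul_one, zero_mul, sub_zero, add_zero, zero_add]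
    have := Real.mul_self_sqrt Real.pi_pos.le
    field_simp
    rw [show √Real.pi ^ 2 = Real.pi by rw [sq, this]]
  have h1 := ((Ht_summable x hy 0).mul_left ((√Real.pi : ℝ) : ℂ)).hasSum
  rw [tsum_mul_left] at h1
  have hval : ((√Real.pi : ℝ) : ℂ) * HH x y 0 = ((((√Real.pi : ℝ) : ℂ) * HH x y 0).re : ℂ) := by
    have h1' := h1
    simp_rw [hterm] at h1'
    have h2 := Complex.hasSum_im h1'
    simp only [Complex.ofReal_im] at h2
    have := h2.unique hasSum_zero
    apply Complex.ext
    · simp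
    · rw [Complex.ofReal_im]; exact this
  have h2 := Complex.hasSum_re h1
  simp_rw [hterm, Complex.ofReal_re] at h2
  have h3 := h2.prod_fiberwise (g := fun m => 2 * (-Complex.log (1 - q ^ (m + 1))).re) (fun m => by
    exact (Complex.hasSum_re (Complex.hasSum_taylorSeries_neg_log' (hqm m))).mul_left 2)
  have h4 := h3.mul_left (-(1/2))
  refine ⟨-(1/2) * (((√Real.pi : ℝ) : ℂ) * HH x y 0).re, ?_, ?_⟩
  · conv_lhs => rw [hval]
    congr 1; ring
  have h5 : HasSum (fun m : ℕ => Real.log ‖1 - q ^ (m + 1)‖) (-(1/2) * (((√Real.pi : ℝ) : ℂ) * HH x y 0).re) := by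
    refine h4.congr_fun fun m => ?_
    rw [Complex.neg_re, Complex.log_re]; ring
  have h6 := h5.rexp
  have h7 : HasProd (fun m : ℕ => ‖1 - q ^ (m + 1)‖) (Real.exp (-(1/2) * (((√Real.pi : ℝ) : ℂ) * HH x y 0).re)) := by
    refine h6.congr_fun fun m => ?_
    simp only [Function.comp]
    rw [Real.exp_log (norm_pos_iff.2 (hne m))]
  have hmul := ModularForm.multipliable_one_sub_pow hq1
  have h8 : ‖∏' m : ℕ, (1 - q ^ (m + 1))‖ = Real.exp (-(1/2) * (((√Real.pi : ℝ) : ℂ) * HH x y 0).re) := by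
    rw [hmul.norm_tprod, h7.tprod_eq]
  have hR : RamanujanDelta τ = q * (∏' m : ℕ, (1 - q ^ (m + 1))) ^ 24 := by
    have hp := hmul.tprod_pow 24
    have hfun : (fun n : ℕ => (1 - Complex.exp (2 * Real.pi * Complex.I * ((n : ℂ) + 1) * τ)) ^ 24) =
        fun n : ℕ => (1 - q ^ (n + 1)) ^ 24 := by
      funext n
      have : q ^ (n + 1) = Complex.exp (2 * Real.pi * Complex.I * ((n : ℂ) + 1) * τ) := by
        rw [hq, ← Complex.exp_nat_mul]
        push_cast
        ring_nf
      rw [this]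
    unfold RamanujanDelta
    rw [hfun, ← hq, hp]
  have hn : ‖RamanujanDelta τ‖ = Real.exp (-2 * Real.pi * y + 24 * (-(1/2) * (((√Real.pi : ℝ) : ℂ) * HH x y 0).re)) := by
    rw [hR, norm_mul, norm_pow, h8, hqn, Real.exp_add, ← Real.exp_nat_mul]
    norm_num
  refine ⟨by rw [hn, Real.log_exp], ?_⟩
  rw [← norm_pos_iff, hn]; exact Real.exp_pos _
end CSF
end

section
open Filter Topology Asymptotics Set MeasureTheory

namespace CSF

/-- the analytic continuation of the Epstein zeta function -/
noncomputable def ZZ (x y : ℝ) (s : ℂ) : ℂ :=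
  2 * riemannZeta (2 * s) + 2 * (s * (Complex.Gamma (s + 1))⁻¹) *
    ((Real.pi : ℂ) ^ s * completedRiemannZeta (2 * s - 1) * (y : ℂ) ^ (1 - 2 * s) + ((√Real.pi : ℝ) : ℂ) * HH x y s)

lemma _root_.HasSum.trans_val {α : Type*} {f : α → ℂ} {a b : ℂ} (h : HasSum f a) (hab : b = a) : HasSum f b :=
  hab ▸ h

lemma invG (s : ℂ) : s * (Complex.Gamma (s + 1))⁻¹ = (Complex.Gamma s)⁻¹ :=
  (Complex.one_div_Gamma_eq_self_mul_one_div_Gamma_add_one s).symm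

lemma ZZ_hasSum (x : ℝ) {y : ℝ} (hy : 0 < y) {s : ℂ} (hs : 1 < s.re) :
    HasSum (fun p : ℤ × ℤ => (((p.2 + p.1 * x) ^ 2 + (p.1 * y) ^ 2 : ℝ) : ℂ) ^ (-s)) (ZZ x y s) := by
  have hG : Complex.Gamma s ≠ 0 := Complex.Gamma_ne_zero_of_re_pos (by linarith)
  have h := (full_sum x hy hs).mul_left (Complex.Gamma s)⁻¹
  have h2 := h.congr_fun (g := fun p : ℤ × ℤ => (((p.2 + p.1 * x) ^ 2 + (p.1 * y) ^ 2 : ℝ) : ℂ) ^ (-s))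
    fun p => by rw [inv_mul_cancel_left₀ hG]
  refine HasSum.trans_val h2 ?_
  have hu : (2 * s - 1 : ℂ) ≠ 0 := by
    intro h0
    have := congrArg Complex.re h0
    simp at this; linarith
  have hGR : Complex.Gammaℝ (2 * s - 1) ≠ 0 := Complex.Gammaℝ_ne_zero_of_re_pos (by simp; linarith)
  have hpi : (Real.pi : ℂ) ≠ 0 := by exact_mod_cast Real.pi_ne_zero
  have hL : (Real.pi : ℂ) ^ s * completedRiemannZeta (2 * s - 1) =
      ((√Real.pi : ℝ) : ℂ) * Complex.Gamma (s - 1/2) * riemannZeta (2 * s - 1) := by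
    have h1 : completedRiemannZeta (2 * s - 1) = Complex.Gammaℝ (2 * s - 1) * riemannZeta (2 * s - 1) := by
      rw [riemannZeta_def_of_ne_zero hu]; field_simp
    rw [h1, Complex.Gammaℝ, Real.sqrt_eq_rpow, Complex.ofReal_cpow Real.pi_pos.le]
    have h2 : ((((1:ℝ)/2 : ℝ)) : ℂ) = s + -(2 * s - 1) / 2 := by push_cast; ring
    rw [h2, Complex.cpow_add _ _ hpi]
    rw [show (2 * s - 1) / 2 = s - 1/2 by ring]
    ring
  rw [ZZ, invG, hL]
  field_simp

lemma ZZ_diff (x : ℝ) {y : ℝ} (hy : 0 < y) {s : ℂ} (h1 : s ≠ 1/2) (h2 : s ≠ 1) :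
    DifferentiableAt ℂ (ZZ x y) s := by
  have hpi : (Real.pi : ℂ) ≠ 0 := by exact_mod_cast Real.pi_ne_zero
  have hy' : (y : ℂ) ≠ 0 := by exact_mod_cast hy.ne'
  have d1 : DifferentiableAt ℂ (fun s : ℂ => riemannZeta (2 * s)) s := by
    refine DifferentiableAt.comp s (differentiableAt_riemannZeta ?_) (by fun_prop)
    intro h; apply h1; linear_combination h / 2
  have d2 : DifferentiableAt ℂ (fun s : ℂ => completedRiemannZeta (2 * s - 1)) s := by
    refine DifferentiableAt.comp s (differentiableAt_completedZeta ?_ ?_) (by fun_prop)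
    · intro h; apply h1; linear_combination h / 2
    · intro h; apply h2; linear_combination h / 2
  have d3 : DifferentiableAt ℂ (fun s : ℂ => (Complex.Gamma (s + 1))⁻¹) s :=
    DifferentiableAt.comp s (f := fun s : ℂ => s + 1) (g := fun s => (Complex.Gamma s)⁻¹) (Complex.differentiable_one_div_Gamma _) (by fun_prop)
  have d4 : DifferentiableAt ℂ (fun s : ℂ => (Real.pi : ℂ) ^ s) s :=
    DifferentiableAt.const_cpow differentiableAt_id (Or.inl hpi)
  have d5 : DifferentiableAt ℂ (fun s : ℂ => (y : ℂ) ^ (1 - 2 * s)) s :=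
    DifferentiableAt.const_cpow (by fun_prop) (Or.inl hy')
  have d6 : DifferentiableAt ℂ (HH x y) s := HH_diff x hy s
  unfold ZZ
  fun_prop

lemma ZZ_zero (x y : ℝ) : ZZ x y 0 = -1 := by
  simp [ZZ, riemannZeta_zero]; norm_num

lemma ZZ_deriv (x : ℝ) {y : ℝ} (hy : 0 < y) :
    HasDerivAt (ZZ x y) ((-2 * Real.log (2 * Real.pi) - 1/6 * Real.log ‖RamanujanDelta ⟨x, y⟩‖ : ℝ) : ℂ) 0 := by
  obtain ⟨S, hS, hlog, -⟩ := HH_zero x hy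
  have hpi : (Real.pi : ℂ) ≠ 0 := by exact_mod_cast Real.pi_ne_zero
  have hy' : (y : ℂ) ≠ 0 := by exact_mod_cast hy.ne'
  set B : ℂ → ℂ := fun s => 2 * ((Complex.Gamma (s + 1))⁻¹ *
    ((Real.pi : ℂ) ^ s * completedRiemannZeta (2 * s - 1) * (y : ℂ) ^ (1 - 2 * s) + ((√Real.pi : ℝ) : ℂ) * HH x y s)) with hB
  have d2 : DifferentiableAt ℂ (fun s : ℂ => completedRiemannZeta (2 * s - 1)) 0 := by
    refine DifferentiableAt.comp (0:ℂ) (differentiableAt_completedZeta ?_ ?_) (by fun_prop) <;> norm_num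
  have d3 : DifferentiableAt ℂ (fun s : ℂ => (Complex.Gamma (s + 1))⁻¹) 0 :=
    DifferentiableAt.comp (0:ℂ) (f := fun s : ℂ => s + 1) (g := fun s => (Complex.Gamma s)⁻¹) (Complex.differentiable_one_div_Gamma _) (by fun_prop)
  have d4 : DifferentiableAt ℂ (fun s : ℂ => (Real.pi : ℂ) ^ s) 0 :=
    DifferentiableAt.const_cpow differentiableAt_id (Or.inl hpi)
  have d5 : DifferentiableAt ℂ (fun s : ℂ => (y : ℂ) ^ (1 - 2 * s)) 0 :=
    DifferentiableAt.const_cpow (by fun_prop) (Or.inl hy')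
  have d6 : DifferentiableAt ℂ (HH x y) 0 := HH_diff x hy 0
  have hBd : DifferentiableAt ℂ B 0 := by
    simp only [hB]; fun_prop
  have hB0 : B 0 = 2 * ((Real.pi / 6 * y) + ((-2 * S : ℝ) : ℂ)) := by
    simp only [hB]
    have hL : completedRiemannZeta (-1) = Real.pi / 6 := by
      have := completedRiemannZeta_one_sub 2
      rw [show (1 - 2 : ℂ) = -1 by norm_num] at this
      rw [this]
      have h2 := riemannZeta_def_of_ne_zero (s := 2) two_ne_zero
      rw [riemannZeta_two, Complex.Gammaℝ] at h2
      have h3 : (Real.pi : ℂ) ^ (-(2:ℂ) / 2) * Complex.Gamma (2 / 2) = (Real.pi : ℂ)⁻¹ := by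
        rw [show (-(2:ℂ) / 2) = -1 by norm_num, show ((2:ℂ) / 2) = 1 by norm_num, Complex.cpow_neg_one, Complex.Gamma_one, mul_one]
      rw [h3] at h2
      field_simp at h2 ⊢
      linear_combination -h2
    rw [hS]
    norm_num [hL]
  have hz : HasDerivAt (fun s : ℂ => 2 * riemannZeta (2 * s)) (2 * (-Complex.log (2 * Real.pi) / 2 * 2)) 0 := by
    have h1 : HasDerivAt riemannZeta (-Complex.log (2 * Real.pi) / 2) (2 * 0) := by
      rw [mul_zero, ← deriv_riemannZeta_zero]
      exact (differentiableAt_riemannZeta (by norm_num)).hasDerivAt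
    have h2 : HasDerivAt (fun s : ℂ => 2 * s) 2 0 := by
      simpa using (hasDerivAt_id (0:ℂ)).const_mul 2
    exact (h1.comp (0:ℂ) h2).const_mul 2
  have hprod : HasDerivAt (fun s : ℂ => s * B s) (B 0) 0 := by
    have := (hasDerivAt_id' (0:ℂ)).fun_mul hBd.hasDerivAt
    exact this.congr_deriv (by ring)
  have hfun : ZZ x y = fun s => 2 * riemannZeta (2 * s) + s * B s := by
    funext s
    simp only [ZZ, hB]; ring
  rw [hfun]
  refine (hz.fun_add hprod).congr_deriv ?_
  rw [hB0, hlog]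
  have : Complex.log (2 * Real.pi) = ((Real.log (2 * Real.pi) : ℝ) : ℂ) := by
    rw [Complex.ofReal_log (by positivity)]; push_cast; rfl
  rw [this]
  push_cast
  ring
end CSF
end

section
open Filter Topology Asymptotics Set MeasureTheory
open NumberField
open scoped nonZeroDivisors

namespace CSF
section ideals
variable {E : Type*} [Field E] [NumberField E]

/-- number of ideals of given norm -/
noncomputable def cnt (E : Type*) [Field E] [NumberField E] (n : ℕ) : ℕ :=
  Nat.card {I : Ideal (𝓞 E) // Ideal.absNorm I = n}

lemma cnt_one : cnt E 1 = 1 := by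
  have : {I : Ideal (𝓞 E) // Ideal.absNorm I = 1} ≃ {I : Ideal (𝓞 E) // I = ⊤} :=
    Equiv.subtypeEquivRight fun I => Ideal.absNorm_eq_one_iff
  rw [cnt, Nat.card_congr this]; simp

lemma coprime_of_norm {A B : Ideal (𝓞 E)} (h : (Ideal.absNorm A).Coprime (Ideal.absNorm B)) : IsCoprime A B := by
  rw [Ideal.isCoprime_iff_sup_eq, Ideal.eq_top_iff_one]
  have h1 : (Ideal.absNorm A : 𝓞 E) ∈ A ⊔ B := Ideal.mem_sup_left (Ideal.absNorm_mem A)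
  have h2 : (Ideal.absNorm B : 𝓞 E) ∈ A ⊔ B := Ideal.mem_sup_right (Ideal.absNorm_mem B)
  obtain ⟨u, v, huv⟩ := (Nat.isCoprime_iff_coprime.2 h)
  have : (1 : 𝓞 E) = u * (Ideal.absNorm A : 𝓞 E) + v * (Ideal.absNorm B : 𝓞 E) := by
    have := congrArg (fun z : ℤ => (z : 𝓞 E)) huv
    push_cast at this
    exact this.symm
  rw [this]
  exact Ideal.add_mem _ (Ideal.mul_mem_left _ _ h1) (Ideal.mul_mem_left _ _ h2)

lemma cnt_mul {m n : ℕ} (hm0 : m ≠ 0) (hn0 : n ≠ 0) (h : m.Coprime n) : cnt E (m * n) = cnt E m * cnt E n := by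
  rw [cnt, cnt, cnt, ← Nat.card_prod]
  symm
  refine Nat.card_congr (Equiv.ofBijective
    (fun p => ⟨p.1.1 * p.2.1, by rw [map_mul, p.1.2, p.2.2]⟩) ⟨?_, ?_⟩)
  · rintro ⟨⟨A, hA⟩, ⟨B, hB⟩⟩ ⟨⟨A', hA'⟩, ⟨B', hB'⟩⟩ hh
    have hh : A * B = A' * B' := congrArg Subtype.val hh
    have c1 : IsCoprime A B' := coprime_of_norm (by rw [hA, hB']; exact h)
    have c2 : IsCoprime A' B := coprime_of_norm (by rw [hA', hB]; exact h)
    have c3 : IsCoprime B A' := coprime_of_norm (by rw [hA', hB]; exact h.symm)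
    have c4 : IsCoprime B' A := coprime_of_norm (by rw [hA, hB']; exact h.symm)
    have e1 : A = A' := dvd_antisymm (c1.dvd_of_dvd_mul_right (hh ▸ Dvd.intro _ rfl)) (c2.dvd_of_dvd_mul_right (hh.symm ▸ Dvd.intro _ rfl))
    have e2 : B = B' := dvd_antisymm (c3.dvd_of_dvd_mul_left (hh ▸ Dvd.intro_left _ rfl)) (c4.dvd_of_dvd_mul_left (hh.symm ▸ Dvd.intro_left _ rfl))
    subst e1; subst e2; rfl
  · rintro ⟨I, hI⟩
    have h1 : I ∣ Ideal.span {(m : 𝓞 E)} * Ideal.span {(n : 𝓞 E)} := by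
      rw [Ideal.dvd_iff_le, Ideal.span_singleton_mul_span_singleton, Ideal.span_singleton_le_iff_mem]
      have := Ideal.absNorm_mem I
      rwa [hI, Nat.cast_mul] at this
    obtain ⟨A, B, hA, hB, rfl⟩ := exists_dvd_and_dvd_of_dvd_mul h1
    rw [map_mul] at hI
    have nA : Ideal.absNorm A ∣ m ^ Module.finrank ℤ (𝓞 E) := by
      rw [← Ideal.absNorm_span_natCast]; exact Ideal.absNorm_dvd_absNorm_of_le (Ideal.dvd_iff_le.1 hA)
    have nB : Ideal.absNorm B ∣ n ^ Module.finrank ℤ (𝓞 E) := by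
      rw [← Ideal.absNorm_span_natCast]; exact Ideal.absNorm_dvd_absNorm_of_le (Ideal.dvd_iff_le.1 hB)
    have cA : (Ideal.absNorm A).Coprime n := Nat.Coprime.coprime_dvd_left nA (h.pow_left _)
    have cB : (Ideal.absNorm B).Coprime m := Nat.Coprime.coprime_dvd_left nB (h.symm.pow_left _)
    have dA : Ideal.absNorm A ∣ m := cA.dvd_of_dvd_mul_right (hI ▸ Dvd.intro _ rfl)
    have dB : Ideal.absNorm B ∣ n := cB.dvd_of_dvd_mul_left (hI ▸ Dvd.intro_left _ rfl)
    have lA := Nat.le_of_dvd (Nat.pos_of_ne_zero hm0) dA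
    have lB := Nat.le_of_dvd (Nat.pos_of_ne_zero hn0) dB
    have hm := Nat.pos_of_ne_zero hm0
    have hn := Nat.pos_of_ne_zero hn0
    have eA : Ideal.absNorm A = m := by nlinarith
    have eB : Ideal.absNorm B = n := by
      rw [eA] at hI; exact Nat.eq_of_mul_eq_mul_left hm hI
    exact ⟨(⟨A, eA⟩, ⟨B, eB⟩), rfl⟩

/-- inert primes -/
lemma inert_pow (hdeg : Module.finrank ℚ E = 2) {p : ℕ} (hp : p.Prime)
    (h : (Ideal.span {(p : 𝓞 E)}).IsPrime) (k : ℕ) :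
    ∀ I : Ideal (𝓞 E), Ideal.absNorm I = p ^ k → ∃ j, 2 * j = k ∧ I = Ideal.span {(p : 𝓞 E)} ^ j := by
  have hN : Ideal.absNorm (Ideal.span {(p : 𝓞 E)}) = p ^ 2 := by
    rw [Ideal.absNorm_span_natCast, RingOfIntegers.rank, hdeg]
  induction k using Nat.strong_induction_on with
  | _ k ih =>
  intro I hI
  rcases Nat.eq_zero_or_pos k with rfl | hk
  · refine ⟨0, rfl, ?_⟩
    rw [pow_zero, Ideal.absNorm_eq_one_iff] at hI
    rw [hI, pow_zero, Ideal.one_eq_top]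
  · obtain ⟨P, hPm, hPu, hPI⟩ := Ideal.exists_isMaximal_dvd_of_dvd_absNorm' hp I (hI ▸ dvd_pow_self p hk.ne')
    have hpP : (p : 𝓞 E) ∈ P := by
      have : (p : ℤ) ∈ P.under ℤ := by rw [hPu]; exact Ideal.mem_span_singleton_self _
      simpa [Ideal.under] using this
    have hne : Ideal.span {(p : 𝓞 E)} ≠ ⊥ := by
      rw [Ne, Ideal.span_singleton_eq_bot]; exact_mod_cast hp.ne_zero
    have hmax := h.isMaximal hne
    have : Ideal.span {(p : 𝓞 E)} = P := hmax.eq_of_le hPm.ne_top (by rwa [Ideal.span_singleton_le_iff_mem])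
    subst this
    obtain ⟨J, rfl⟩ := hPI
    rw [map_mul, hN] at hI
    have hk2 : 2 ≤ k := by
      by_contra hk2
      have : k = 1 := by omega
      subst this
      have h3 : p ^ 2 ∣ p ^ 1 := hI ▸ Dvd.intro _ rfl
      have := (Nat.pow_dvd_pow_iff_le_right hp.one_lt).1 h3
      omega
    obtain ⟨l, rfl⟩ := Nat.exists_eq_add_of_le hk2
    rw [pow_add] at hI
    have hJ := Nat.eq_of_mul_eq_mul_left (pow_pos hp.pos 2) hI
    obtain ⟨j, hj, rfl⟩ := ih l (by omega) J hJ
    exact ⟨j + 1, by omega, by rw [pow_succ, mul_comm]⟩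

lemma noninert (hdeg : Module.finrank ℚ E = 2) {p : ℕ} (hp : p.Prime)
    (h : ¬ (Ideal.span {(p : 𝓞 E)}).IsPrime) :
    ∃ P Q : Ideal (𝓞 E), P.IsMaximal ∧ Q.IsMaximal ∧ Ideal.absNorm P = p ∧ Ideal.absNorm Q = p ∧
      Ideal.span {(p : 𝓞 E)} = P * Q := by
  have hN : Ideal.absNorm (Ideal.span {(p : 𝓞 E)}) = p ^ 2 := by
    rw [Ideal.absNorm_span_natCast, RingOfIntegers.rank, hdeg]
  obtain ⟨P, hPm, hPu, ⟨Q, hQ⟩⟩ := Ideal.exists_isMaximal_dvd_of_dvd_absNorm' hp (Ideal.span {(p : 𝓞 E)}) (hN ▸ dvd_pow_self p two_ne_zero)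
  have hmul : Ideal.absNorm P * Ideal.absNorm Q = p ^ 2 := by rw [← map_mul, ← hQ, hN]
  obtain ⟨i, hi, hPi⟩ := (Nat.dvd_prime_pow hp).1 (Dvd.intro _ hmul)
  have hi1 : i = 1 := by
    interval_cases i
    · exfalso
      rw [pow_zero, Ideal.absNorm_eq_one_iff] at hPi
      exact hPm.ne_top hPi
    · rfl
    · exfalso
      rw [hPi] at hmul
      have : Ideal.absNorm Q = 1 := by
        have := pow_pos hp.pos 2
        nlinarith
      rw [Ideal.absNorm_eq_one_iff] at this
      rw [this, ← Ideal.one_eq_top, mul_one] at hQ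
      exact h (hQ ▸ hPm.isPrime)
  rw [hi1, pow_one] at hPi
  have hQn : Ideal.absNorm Q = p := by
    rw [hPi, sq] at hmul; exact Nat.eq_of_mul_eq_mul_left hp.pos hmul
  refine ⟨P, Q, hPm, ?_, hPi, hQn, hQ⟩
  have : Q.IsPrime := Ideal.isPrime_of_irreducible_absNorm (by rw [hQn]; exact hp)
  refine this.isMaximal ?_
  rintro rfl
  rw [Ideal.absNorm_bot] at hQn
  exact hp.ne_zero hQn.symm

lemma noninert_pow {p : ℕ} (hp : p.Prime) {P Q : Ideal (𝓞 E)} (hP : P.IsMaximal) (hQ : Q.IsMaximal)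
    (nP : Ideal.absNorm P = p) (nQ : Ideal.absNorm Q = p) (h : Ideal.span {(p : 𝓞 E)} = P * Q) (k : ℕ) :
    ∀ I : Ideal (𝓞 E), Ideal.absNorm I = p ^ k → ∃ i j, i + j = k ∧ I = P ^ i * Q ^ j := by
  induction k with
  | zero =>
    intro I hI
    refine ⟨0, 0, rfl, ?_⟩
    rw [pow_zero, Ideal.absNorm_eq_one_iff] at hI
    rw [hI, pow_zero, pow_zero, mul_one, Ideal.one_eq_top]
  | succ k ih =>
    intro I hI
    obtain ⟨R, hRm, hRu, hRI⟩ := Ideal.exists_isMaximal_dvd_of_dvd_absNorm' hp I (hI ▸ dvd_pow_self p (by omega))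
    have hpR : (p : 𝓞 E) ∈ R := by
      have : (p : ℤ) ∈ R.under ℤ := by rw [hRu]; exact Ideal.mem_span_singleton_self _
      simpa [Ideal.under] using this
    have hle : P * Q ≤ R := by rw [← h, Ideal.span_singleton_le_iff_mem]; exact hpR
    obtain ⟨J, rfl⟩ := hRI
    rw [map_mul, pow_succ'] at hI
    rcases (hRm.isPrime.mul_le).1 hle with hh | hh
    · have e := hP.eq_of_le hRm.ne_top hh
      subst e
      rw [nP] at hI
      obtain ⟨i, j, hij, rfl⟩ := ih J (Nat.eq_of_mul_eq_mul_left hp.pos hI)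
      exact ⟨i + 1, j, by omega, by ring⟩
    · have e := hQ.eq_of_le hRm.ne_top hh
      subst e
      rw [nQ] at hI
      obtain ⟨i, j, hij, rfl⟩ := ih J (Nat.eq_of_mul_eq_mul_left hp.pos hI)
      exact ⟨i, j + 1, by omega, by ring⟩

end ideals
end CSF
end

section
open Filter Topology Asymptotics Set MeasureTheory
open NumberField
open scoped nonZeroDivisors

namespace CSF
section ideals
variable {E : Type*} [Field E] [NumberField E]

lemma cnt_inert (hdeg : Module.finrank ℚ E = 2) {p : ℕ} (hp : p.Prime)
    (h : (Ideal.span {(p : 𝓞 E)}).IsPrime) (k : ℕ) :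
    (cnt E (p ^ k) : ℤ) = ∑ i ∈ Finset.range (k + 1), (-1) ^ i := by
  have hN : Ideal.absNorm (Ideal.span {(p : 𝓞 E)}) = p ^ 2 := by
    rw [Ideal.absNorm_span_natCast, RingOfIntegers.rank, hdeg]
  rw [neg_one_geom_sum]
  rcases Nat.even_or_odd' k with ⟨j, rfl | rfl⟩
  · rw [if_neg (by simp [Nat.even_add_one])]
    have e : {I : Ideal (𝓞 E) // Ideal.absNorm I = p ^ (2 * j)} ≃ {I : Ideal (𝓞 E) // I = Ideal.span {(p : 𝓞 E)} ^ j} := by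
      refine Equiv.subtypeEquivRight fun I => ⟨fun hI => ?_, fun hI => ?_⟩
      · obtain ⟨j', hj, rfl⟩ := inert_pow hdeg hp h _ I hI
        rw [show j' = j by omega]
      · rw [hI, map_pow, hN, pow_mul]
    rw [cnt, Nat.card_congr e]; simp
  · rw [if_pos (by rw [Nat.even_add_one, Nat.not_even_iff_odd]; exact ⟨j, rfl⟩)]
    have e : IsEmpty {I : Ideal (𝓞 E) // Ideal.absNorm I = p ^ (2 * j + 1)} := by
      refine ⟨fun ⟨I, hI⟩ => ?_⟩
      obtain ⟨j', hj, rfl⟩ := inert_pow hdeg hp h _ I hI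
      omega
    rw [cnt, Nat.card_of_isEmpty]; rfl

lemma cnt_ram {p : ℕ} (hp : p.Prime) {P : Ideal (𝓞 E)} (hP : P.IsMaximal)
    (nP : Ideal.absNorm P = p) (h : Ideal.span {(p : 𝓞 E)} = P * P) (k : ℕ) :
    cnt E (p ^ k) = 1 := by
  have e : {I : Ideal (𝓞 E) // Ideal.absNorm I = p ^ k} ≃ {I : Ideal (𝓞 E) // I = P ^ k} := by
    refine Equiv.subtypeEquivRight fun I => ⟨fun hI => ?_, fun hI => ?_⟩
    · obtain ⟨i, j, hj, rfl⟩ := noninert_pow hp hP hP nP nP h k I hI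
      rw [← pow_add, hj]
    · rw [hI, map_pow, nP]
  rw [cnt, Nat.card_congr e]; simp

lemma cnt_split {p : ℕ} (hp : p.Prime) {P Q : Ideal (𝓞 E)} (hP : P.IsMaximal) (hQ : Q.IsMaximal)
    (nP : Ideal.absNorm P = p) (nQ : Ideal.absNorm Q = p) (h : Ideal.span {(p : 𝓞 E)} = P * Q)
    (hPQ : P ≠ Q) (k : ℕ) :
    cnt E (p ^ k) = k + 1 := by
  have hP0 : P ≠ 0 := by
    rintro rfl; rw [map_zero] at nP; exact hp.ne_zero nP.symm
  have e : Fin (k + 1) ≃ {I : Ideal (𝓞 E) // Ideal.absNorm I = p ^ k} := by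
    refine Equiv.ofBijective (fun i => ⟨P ^ (i : ℕ) * Q ^ (k - i : ℕ), ?_⟩) ⟨?_, ?_⟩
    · rw [map_mul, map_pow, map_pow, nP, nQ, ← pow_add]
      congr 1; omega
    · have key : ∀ a b c d : ℕ, a < b → P ^ a * Q ^ c = P ^ b * Q ^ d → False := by
        intro a b c d hab he
        obtain ⟨l, rfl⟩ := Nat.exists_eq_add_of_lt hab
        rw [pow_succ, pow_add, mul_assoc, mul_assoc] at he
        have he := mul_left_cancel₀ (pow_ne_zero a hP0) he
        have hd : P ∣ Q ^ c := he ▸ (Dvd.intro _ rfl : P ∣ P * Q ^ d).mul_left _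
        have hd2 : P ∣ Q := (Ideal.prime_of_isPrime hP0 hP.isPrime).dvd_of_dvd_pow hd
        exact hPQ (hQ.eq_of_le hP.ne_top (Ideal.dvd_iff_le.1 hd2)).symm
      intro i i' hh
      have hh := congrArg Subtype.val hh
      simp only at hh
      rcases lt_trichotomy (i : ℕ) i' with h1 | h1 | h1
      · exact (key _ _ _ _ h1 hh).elim
      · exact Fin.ext h1
      · exact (key _ _ _ _ h1 hh.symm).elim
    · rintro ⟨I, hI⟩
      obtain ⟨i, j, hj, rfl⟩ := noninert_pow hp hP hQ nP nQ h k I hI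
      refine ⟨⟨i, by omega⟩, ?_⟩
      simp only [Subtype.mk.injEq]
      rw [show k - i = j by omega]
  rw [cnt, ← Nat.card_congr e]; simp

lemma map_span (p : ℕ) : Ideal.map (algebraMap ℤ (𝓞 E)) (Ideal.span {(p : ℤ)}) = Ideal.span {(p : 𝓞 E)} := by
  rw [Ideal.map_span]; simp

lemma disc_of_ram {p : ℕ} (hp : p.Prime) {P : Ideal (𝓞 E)} 
    (nP : Ideal.absNorm P = p) (h : Ideal.span {(p : 𝓞 E)} = P * P) : (p : ℤ) ∣ discr E := by
  have hpp : Prime (p : ℤ) := Nat.prime_iff_prime_int.1 hp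
  have hne : Ideal.span {(p : ℤ)} ≠ ⊥ := by simpa using hp.ne_zero
  have hmax : (Ideal.span {(p : ℤ)}).IsMaximal :=
    ((Ideal.span_singleton_prime hpp.ne_zero).mpr hpp).isMaximal hne
  have h1 := pow_sub_one_dvd_differentIdeal ℤ P 2 hne (by rw [map_span, h, sq])
  have h2 := Ideal.absNorm_dvd_absNorm_of_le (Ideal.dvd_iff_le.1 h1)
  rw [absNorm_differentIdeal E (𝓞 E)] at h2
  simp only [Nat.add_one_sub_one, pow_one] at h2
  rw [nP] at h2
  exact Int.natCast_dvd.2 h2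

lemma not_disc {p : ℕ} (hp : p.Prime) 
    (H : ∀ P : Ideal (𝓞 E), P.IsMaximal → (p : 𝓞 E) ∈ P → ∃ Q, IsCoprime P Q ∧ P * Q = Ideal.span {(p : 𝓞 E)}) :
    ¬ (p : ℤ) ∣ discr E := by
  intro hd
  have hpp : Prime (p : ℤ) := Nat.prime_iff_prime_int.1 hp
  have hne : Ideal.span {(p : ℤ)} ≠ ⊥ := by simpa using hp.ne_zero
  have hmax : (Ideal.span {(p : ℤ)}).IsMaximal :=
    ((Ideal.span_singleton_prime hpp.ne_zero).mpr hpp).isMaximal hne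
  have : Finite (ℤ ⧸ Ideal.span {(p : ℤ)}) := by
    have : NeZero p := ⟨hp.ne_zero⟩
    exact Finite.of_equiv _ (Int.quotientSpanNatEquivZMod p).symm.toEquiv
  have h2 : p ∣ Ideal.absNorm (differentIdeal ℤ (𝓞 E)) := by
    rw [absNorm_differentIdeal E (𝓞 E)]; exact Int.natCast_dvd.1 hd
  obtain ⟨P, hPm, hPu, hPI⟩ := Ideal.exists_isMaximal_dvd_of_dvd_absNorm' hp _ h2
  have hpP : (p : 𝓞 E) ∈ P := by
    have : (p : ℤ) ∈ P.under ℤ := by rw [hPu]; exact Ideal.mem_span_singleton_self _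
    simpa [Ideal.under] using this
  obtain ⟨Q, hQ1, hQ2⟩ := H P hPm hpP
  exact not_dvd_differentIdeal_of_isCoprime ℤ (p := Ideal.span {(p : ℤ)}) P Q hQ1 (by rw [map_span, hQ2]) hPI

lemma inert_not_disc {p : ℕ} (hp : p.Prime)
    (h : (Ideal.span {(p : 𝓞 E)}).IsPrime) : ¬ (p : ℤ) ∣ discr E := by
  refine not_disc hp fun P hP hpP => ⟨⊤, ?_, ?_⟩
  · rw [Ideal.isCoprime_iff_sup_eq]; simp
  · have hne : Ideal.span {(p : 𝓞 E)} ≠ ⊥ := by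
      rw [Ne, Ideal.span_singleton_eq_bot]; exact_mod_cast hp.ne_zero
    have hmax := h.isMaximal hne
    rw [← Ideal.one_eq_top, mul_one]
    exact (hmax.eq_of_le hP.ne_top (by rwa [Ideal.span_singleton_le_iff_mem])).symm

lemma split_not_disc {p : ℕ} (hp : p.Prime) {P Q : Ideal (𝓞 E)} (hP : P.IsMaximal) (hQ : Q.IsMaximal)
    (h : Ideal.span {(p : 𝓞 E)} = P * Q)
    (hPQ : P ≠ Q) : ¬ (p : ℤ) ∣ discr E := by
  refine not_disc hp fun R hRm hpR => ?_
  have hle : P * Q ≤ R := by rw [← h, Ideal.span_singleton_le_iff_mem]; exact hpR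
  have hc : IsCoprime P Q := by
    rw [Ideal.isCoprime_iff_sup_eq]; exact hP.coprime_of_ne hQ hPQ
  rcases (hRm.isPrime.mul_le).1 hle with hh | hh
  · have e := hP.eq_of_le hRm.ne_top hh
    subst e
    exact ⟨Q, hc, h.symm⟩
  · have e := hQ.eq_of_le hRm.ne_top hh
    subst e
    exact ⟨P, hc.symm, by rw [h, mul_comm]⟩

noncomputable def cntA (E : Type*) [Field E] [NumberField E] : ArithmeticFunction ℂ :=
  ⟨fun n => if n = 0 then 0 else (cnt E n : ℂ), by simp⟩

lemma cntA_apply {n : ℕ} (hn : n ≠ 0) : cntA E n = cnt E n := by simp [cntA, hn]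

lemma cntA_mult : (cntA E).IsMultiplicative := by
  rw [ArithmeticFunction.IsMultiplicative.iff_ne_zero]
  refine ⟨by rw [cntA_apply one_ne_zero, cnt_one]; simp, fun {m n} hm hn h => ?_⟩
  rw [cntA_apply hm, cntA_apply hn, cntA_apply (mul_ne_zero hm hn), cnt_mul hm hn h]
  push_cast; rfl

lemma cntA_eq {d : ℕ} (hdeg : Module.finrank ℚ E = 2)
    (hdisc : NumberField.discr E = -(d : ℤ)) (χ : DirichletCharacter ℂ d)
    (hχquad : ∀ u : (ZMod d)ˣ, χ u = 1 ∨ χ u = -1)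
    (hχ : ∀ p : ℕ, p.Prime → ¬ p ∣ d →
      (χ (p : ZMod d) = -1 ↔ (Ideal.span {(p : 𝓞 E)} : Ideal (𝓞 E)).IsPrime)) :
    cntA E = χ.zetaMul := by
  rw [ArithmeticFunction.IsMultiplicative.eq_iff_eq_on_prime_powers _ cntA_mult _ χ.isMultiplicative_zetaMul]
  intro p k hp
  have hz : χ.zetaMul (p ^ k) = ∑ i ∈ Finset.range (k + 1), χ (p : ZMod d) ^ i := by
    have e : χ.zetaMul (p ^ k) = ∑ i ∈ (p ^ k).divisors, toArithmeticFunction (fun n : ℕ => χ (n : ZMod d)) i := by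
      unfold DirichletCharacter.zetaMul
      exact ArithmeticFunction.coe_zeta_mul_apply
    rw [e, Nat.sum_divisors_prime_pow hp]
    refine Finset.sum_congr rfl fun i _ => ?_
    have h0 : p ^ i ≠ 0 := pow_ne_zero _ hp.ne_zero
    change (if p ^ i = 0 then (0:ℂ) else χ ((p ^ i : ℕ) : ZMod d)) = _
    rw [if_neg h0, Nat.cast_pow, map_pow]
  rw [hz, cntA_apply (pow_ne_zero _ hp.ne_zero)]
  have hdd : (p : ℤ) ∣ discr E ↔ p ∣ d := by
    rw [hdisc, dvd_neg]; exact Int.natCast_dvd_natCast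
  by_cases hI : (Ideal.span {(p : 𝓞 E)} : Ideal (𝓞 E)).IsPrime
  · have h1 := inert_not_disc hp hI
    rw [hdd] at h1
    rw [(hχ p hp h1).2 hI]
    exact_mod_cast congrArg (fun z : ℤ => (z : ℂ)) (cnt_inert hdeg hp hI k)
  · obtain ⟨P, Q, hP, hQ, nP, nQ, hPQ⟩ := noninert hdeg hp hI
    by_cases he : P = Q
    · subst he
      have h1 := disc_of_ram hp nP hPQ
      rw [hdd] at h1
      have h0 : χ (p : ZMod d) = 0 := by
        apply MulChar.map_nonunit
        rw [ZMod.isUnit_iff_coprime]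
        intro hc
        exact hp.one_lt.ne' (Nat.Coprime.eq_one_of_dvd hc h1)
      rw [h0, cnt_ram hp hP nP hPQ, Finset.sum_range_succ']
      simp
    · have h1 := split_not_disc hp hP hQ hPQ he
      rw [hdd] at h1
      have hu : IsUnit (p : ZMod d) := by
        rw [ZMod.isUnit_iff_coprime]
        exact (Nat.Prime.coprime_iff_not_dvd hp).2 h1
      have h2 : χ (p : ZMod d) = 1 := by
        rcases hχquad hu.unit with h | h
        · simpa using h
        · exact (hI ((hχ p hp h1).1 (by simpa using h))).elim
      rw [h2, cnt_split hp hP hQ nP nQ hPQ he]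
      simp
end ideals
end CSF
end

section
open Filter Topology Asymptotics Set MeasureTheory
open NumberField
open scoped nonZeroDivisors
namespace CSF
lemma zetaMul_LSeries {d : ℕ} [NeZero d] (χ : DirichletCharacter ℂ d) {s : ℂ} (hs : 1 < s.re) :
    LSeries χ.zetaMul s = riemannZeta s * DirichletCharacter.LFunction χ s := by
  rw [DirichletCharacter.zetaMul, ← ArithmeticFunction.coe_mul, LSeries_convolution']
  · rw [χ.LFunction_eq_LSeries hs]
    congr 1
    · simp_rw [← ArithmeticFunction.LSeries_zeta_eq_riemannZeta hs, ← ArithmeticFunction.natCoe_apply]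
    · exact (LSeries_congr χ.apply_eq_toArithmeticFunction_apply s).symm
  · exact ArithmeticFunction.LSeriesSummable_zeta_iff.mpr hs
  · exact (LSeriesSummable_congr _ fun h ↦ (χ.apply_eq_toArithmeticFunction_apply h).symm).mpr <|
      ZMod.LSeriesSummable_of_one_lt_re χ hs

/-- fiberwise summation over ideals by norm -/
lemma ideal_hasSum {E : Type*} [Field E] [NumberField E] {s : ℂ} {S : ℂ}
    (hsum : LSeriesSummable (cntA E) s) (hS : LSeries (cntA E) s = S) :
    HasSum (fun I : {I : Ideal (𝓞 E) // I ≠ ⊥} => ((Ideal.absNorm I.1 : ℕ) : ℂ) ^ (-s)) S := by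
  classical
  let f : {I : Ideal (𝓞 E) // I ≠ ⊥} → ℂ := fun I => ((Ideal.absNorm I.1 : ℕ) : ℂ) ^ (-s)
  let N : {I : Ideal (𝓞 E) // I ≠ ⊥} → ℕ := fun I => Ideal.absNorm I.1
  have hN0 : ∀ I, N I ≠ 0 := fun I => by
    simpa [N, Ideal.absNorm_eq_zero_iff] using I.2
  have hfin : ∀ n, Finite {I // N I = n} := by
    intro n
    have := Ideal.finite_setOfPred_absNorm_eq (S := 𝓞 E) n
    have hf : Finite {I : Ideal (𝓞 E) // Ideal.absNorm I = n} := this.to_subtype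
    exact Finite.of_injective (fun I => (⟨I.1.1, I.2⟩ : {I : Ideal (𝓞 E) // Ideal.absNorm I = n}))
      (fun I J h => by
        apply Subtype.ext; apply Subtype.ext
        simpa using h)
  have hcard : ∀ n, n ≠ 0 → Nat.card {I // N I = n} = cnt E n := by
    intro n hn
    unfold cnt
    refine Nat.card_congr ⟨fun I => ⟨I.1.1, I.2⟩, fun I => ⟨⟨I.1, ?_⟩, I.2⟩, fun I => rfl, fun I => rfl⟩
    rintro h
    apply hn; rw [← I.2, h]; simp
  have hf : ∀ n (I : {I // N I = n}), f I.1 = (n : ℂ) ^ (-s) := fun n I => by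
    simp only [f]; rw [show Ideal.absNorm I.1.1 = n from I.2]
  have key : ∀ n, (Nat.card {I // N I = n} : ℂ) * (n : ℂ) ^ (-s) = LSeries.term (cntA E) s n := by
    intro n
    by_cases hn : n = 0
    · subst hn
      have : IsEmpty {I // N I = 0} := ⟨fun I => hN0 _ I.2⟩
      simp
    · rw [LSeries.term_of_ne_zero hn, hcard n hn, cntA_apply hn, Complex.cpow_neg, div_eq_mul_inv]
  have hin : ∀ n, HasSum (fun I : {I // N I = n} => f I.1) (LSeries.term (cntA E) s n) := by
    intro n
    have := Fintype.ofFinite {I // N I = n}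
    have h1 := hasSum_fintype (fun I : {I // N I = n} => f I.1)
    rw [← key]
    refine h1.trans_val ?_
    rw [Finset.sum_congr rfl (fun I _ => hf n I)]
    simp [Nat.card_eq_fintype_card]
  have hsf : Summable (fun p : Σ n, {I // N I = n} => f p.2.1) := by
    refine Summable.of_norm ?_
    rw [summable_sigma_of_nonneg (fun _ => norm_nonneg _)]
    refine ⟨fun n => summable_of_finite_support (Set.toFinite _), ?_⟩
    refine (hsum.norm).congr fun n => ?_
    have := Fintype.ofFinite {I // N I = n}
    rw [tsum_fintype, ← key]
    rw [Finset.sum_congr rfl (fun I _ => by rw [hf n I])]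
    simp [Nat.card_eq_fintype_card]
  have h2 : HasSum (fun p : Σ n, {I // N I = n} => f p.2.1) S := by
    have h3 := hsf.hasSum
    have h4 := h3.sigma hin
    have h5 : HasSum (LSeries.term (cntA E) s) S := by
      rw [← hS]; exact hsum.hasSum
    rw [← h4.unique h5]; exact h3
  exact (Equiv.hasSum_iff (Equiv.sigmaFiberEquiv N) (f := f)).1 h2

lemma ideal_zeta {E : Type*} [Field E] [NumberField E] {d : ℕ} [NeZero d] (hdeg : Module.finrank ℚ E = 2)
    (hdisc : NumberField.discr E = -(d : ℤ)) (χ : DirichletCharacter ℂ d)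
    (hχquad : ∀ u : (ZMod d)ˣ, χ u = 1 ∨ χ u = -1)
    (hχ : ∀ p : ℕ, p.Prime → ¬ p ∣ d →
      (χ (p : ZMod d) = -1 ↔ (Ideal.span {(p : 𝓞 E)} : Ideal (𝓞 E)).IsPrime)) {s : ℂ} (hs : 1 < s.re) :
    HasSum (fun I : {I : Ideal (𝓞 E) // I ≠ ⊥} => ((Ideal.absNorm I.1 : ℕ) : ℂ) ^ (-s))
      (riemannZeta s * DirichletCharacter.LFunction χ s) := by
  have e := cntA_eq hdeg hdisc χ hχquad hχ
  apply ideal_hasSum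
  · rw [e]; exact χ.LSeriesSummable_zetaMul hs
  · rw [e]; exact zetaMul_LSeries χ hs
end CSF
end

section
open Filter Topology Asymptotics Set MeasureTheory
open NumberField
open scoped nonZeroDivisors
namespace CSF
section fieldlem
variable {E : Type*} [Field E] [NumberField E]

lemma places (hdeg : Module.finrank ℚ E = 2) (hneg : NumberField.discr E < 0) :
    InfinitePlace.nrRealPlaces E = 0 ∧ InfinitePlace.nrComplexPlaces E = 1 := by
  have h1 := InfinitePlace.card_add_two_mul_card_eq_rank E
  have h2 := NumberField.sign_discr E
  rw [hdeg] at h1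
  rw [Int.sign_eq_neg_one_of_neg hneg] at h2
  have h3 : InfinitePlace.nrComplexPlaces E ≠ 0 := by
    intro h; rw [h] at h2; norm_num at h2
  omega

lemma totC (hdeg : Module.finrank ℚ E = 2) (hneg : NumberField.discr E < 0) :
    IsTotallyComplex E := by
  rw [← nrRealPlaces_eq_zero_iff]
  exact (places hdeg hneg).1

lemma norm_emb (hdeg : Module.finrank ℚ E = 2) (hneg : NumberField.discr E < 0) (ι : E →+* ℂ) (x : E) :
    ((|Algebra.norm ℚ x| : ℚ) : ℝ) = ‖ι x‖ ^ 2 := by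
  have := totC hdeg hneg
  have hp := places hdeg hneg
  have hc : Fintype.card (InfinitePlace E) = 1 := by
    rw [InfinitePlace.card_eq_nrRealPlaces_add_nrComplexPlaces, hp.1, hp.2]
  have hs : Subsingleton (InfinitePlace E) := (Fintype.card_le_one_iff_subsingleton).1 hc.le
  have h := InfinitePlace.prod_eq_abs_norm x
  rw [Fintype.prod_subsingleton _ (InfinitePlace.mk ι), IsTotallyComplex.mult_eq, InfinitePlace.apply] at h
  rw [h]

lemma basis_exists (hdeg : Module.finrank ℚ E = 2) (hneg : NumberField.discr E < 0) (ι : E →+* ℂ)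
    (𝔞 : (FractionalIdeal (𝓞 E)⁰ E)ˣ) :
    ∃ a b : E, ι b ≠ 0 ∧ 0 < (ι a / ι b).im ∧
      ∀ x, x ∈ (𝔞 : FractionalIdeal (𝓞 E)⁰ E) ↔ ∃ m n : ℤ, x = m * a + n * b := by
  have := totC hdeg hneg
  have hcard : Fintype.card (Module.Free.ChooseBasisIndex ℤ 𝔞) = 2 := by
    rw [← Module.finrank_eq_card_basis (basisOfFractionalIdeal E 𝔞), hdeg]
  let B := (basisOfFractionalIdeal E 𝔞).reindex (Fintype.equivFinOfCardEq hcard)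
  have hmem : ∀ x, x ∈ (𝔞 : FractionalIdeal (𝓞 E)⁰ E) ↔ ∃ m n : ℤ, x = m * B 0 + n * B 1 := by
    intro x
    have h1 := mem_span_basisOfFractionalIdeal E (I := 𝔞) (x := x)
    have h2 : Set.range (basisOfFractionalIdeal E 𝔞) = {B 0, B 1} := by
      have h3 : Set.range B = Set.range (basisOfFractionalIdeal E 𝔞) := Module.Basis.range_reindex _ _
      rw [← h3]
      ext z; rw [Set.mem_range, Fin.exists_fin_two]; simp [eq_comm]
    rw [h2, Submodule.mem_span_pair] at h1
    rw [show x ∈ (𝔞 : FractionalIdeal (𝓞 E)⁰ E) ↔ x ∈ ((𝔞 : FractionalIdeal (𝓞 E)⁰ E) : Set E) from Iff.rfl, ← h1]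
    simp [zsmul_eq_mul, eq_comm]
  have hb : ∀ i, ι (B i) ≠ 0 := fun i => by
    rw [Ne, map_eq_zero]; exact B.ne_zero i
  have him : (ι (B 0) / ι (B 1)).im ≠ 0 := by
    intro h0
    apply IsTotallyComplex.complexEmbedding_not_isReal ι
    have hr : ∀ y : E, (ι y).im = 0 := by
      intro y
      have h1 := B.sum_repr (y * B 1)
      rw [Fin.sum_univ_two, Algebra.smul_def, Algebra.smul_def] at h1
      have h2 : ι y = ((B.repr (y * B 1) 0 : ℚ) : ℂ) * (ι (B 0) / ι (B 1)) + ((B.repr (y * B 1) 1 : ℚ) : ℂ) := by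
        have h5 := hb 1
        have h6 := congrArg ι h1
        rw [map_add, map_mul ι, map_mul ι, map_mul ι, eq_ratCast, eq_ratCast, map_ratCast, map_ratCast] at h6
        field_simp
        rw [← h6]; ring
      rw [h2]
      simp [h0]
    rw [ComplexEmbedding.isReal_iff]
    ext y
    rw [ComplexEmbedding.conjugate_coe_eq, Complex.conj_eq_iff_im, hr]
  rcases lt_or_gt_of_ne him with h | h
  · refine ⟨-B 0, B 1, hb 1, ?_, fun x => ?_⟩
    · rw [map_neg, neg_div, Complex.neg_im]; linarith
    · rw [hmem]
      constructor
      · rintro ⟨m, n, h⟩; exact ⟨-m, n, by rw [h]; push_cast; ring⟩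
      · rintro ⟨m, n, h⟩; exact ⟨-m, n, by rw [h]; push_cast; ring⟩
  · exact ⟨B 0, B 1, hb 1, h, hmem⟩
end fieldlem
end CSF
end

section
open Filter Topology Asymptotics Set MeasureTheory
open NumberField
open scoped nonZeroDivisors
namespace CSF
section bij
variable {E : Type*} [Field E] [NumberField E]

lemma phi_exists (𝔞 : (FractionalIdeal (𝓞 E)⁰ E)ˣ) (x : E) (hx : x ∈ (𝔞 : FractionalIdeal (𝓞 E)⁰ E)) (h0 : x ≠ 0) :
    ∃ I : {I : Ideal (𝓞 E) // I ≠ ⊥}, (I.1 : FractionalIdeal (𝓞 E)⁰ E) * 𝔞 = FractionalIdeal.spanSingleton (𝓞 E)⁰ x := by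
  have hle : FractionalIdeal.spanSingleton (𝓞 E)⁰ x * ((𝔞⁻¹ : (FractionalIdeal (𝓞 E)⁰ E)ˣ) : FractionalIdeal (𝓞 E)⁰ E) ≤ 1 := by
    rw [← Units.mul_inv 𝔞]
    exact mul_le_mul_left (FractionalIdeal.spanSingleton_le_iff_mem.2 hx) _
  obtain ⟨I, hI⟩ := FractionalIdeal.le_one_iff_exists_coeIdeal.1 hle
  refine ⟨⟨I, ?_⟩, ?_⟩
  · rintro rfl
    rw [FractionalIdeal.coeIdeal_bot] at hI
    have := congrArg (· * (𝔞 : FractionalIdeal (𝓞 E)⁰ E)) hI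
    simp only [zero_mul, mul_assoc, Units.inv_mul, mul_one] at this
    exact h0 (FractionalIdeal.spanSingleton_eq_zero_iff.1 this.symm)
  · simp only [hI, mul_assoc, Units.inv_mul, mul_one]

abbrev Idx (rep : ClassGroup (𝓞 E) → (FractionalIdeal (𝓞 E)⁰ E)ˣ) :=
  Σ C : ClassGroup (𝓞 E), {x : E // x ∈ (rep C : FractionalIdeal (𝓞 E)⁰ E) ∧ x ≠ 0}

noncomputable def PhiI (rep : ClassGroup (𝓞 E) → (FractionalIdeal (𝓞 E)⁰ E)ˣ) (p : Idx rep) :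
    {I : Ideal (𝓞 E) // I ≠ ⊥} :=
  (phi_exists (rep p.1) p.2.1 p.2.2.1 p.2.2.2).choose

lemma PhiI_spec (rep : ClassGroup (𝓞 E) → (FractionalIdeal (𝓞 E)⁰ E)ˣ) (p : Idx rep) :
    ((PhiI rep p).1 : FractionalIdeal (𝓞 E)⁰ E) * rep p.1 = FractionalIdeal.spanSingleton (𝓞 E)⁰ p.2.1 :=
  (phi_exists (rep p.1) p.2.1 p.2.2.1 p.2.2.2).choose_spec

lemma PhiI_eq_iff (rep : ClassGroup (𝓞 E) → (FractionalIdeal (𝓞 E)⁰ E)ˣ) (p : Idx rep)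
    (I : {I : Ideal (𝓞 E) // I ≠ ⊥}) : PhiI rep p = I ↔
    (I.1 : FractionalIdeal (𝓞 E)⁰ E) * rep p.1 = FractionalIdeal.spanSingleton (𝓞 E)⁰ p.2.1 := by
  constructor
  · rintro rfl; exact PhiI_spec rep p
  · intro h
    rw [← PhiI_spec rep p] at h
    apply Subtype.ext
    exact (FractionalIdeal.coeIdeal_injective ((rep p.1).isUnit.mul_left_injective h)).symm

lemma fiber_equiv (rep : ClassGroup (𝓞 E) → (FractionalIdeal (𝓞 E)⁰ E)ˣ)
    (hrep : ∀ C, ClassGroup.mk E (rep C) = C) (I : {I : Ideal (𝓞 E) // I ≠ ⊥}) :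
    Nonempty ((𝓞 E)ˣ ≃ {p // PhiI rep p = I}) := by
  let U : (FractionalIdeal (𝓞 E)⁰ E)ˣ := FractionalIdeal.mk0 E ⟨I.1, mem_nonZeroDivisors_iff_ne_zero.2 I.2⟩
  have hU : (U : FractionalIdeal (𝓞 E)⁰ E) = (I.1 : FractionalIdeal (𝓞 E)⁰ E) := rfl
  obtain ⟨C0, hC0⟩ : ∃ C0, C0 = (ClassGroup.mk E U)⁻¹ := ⟨_, rfl⟩
  have hone : ∀ C (x : E), x ≠ 0 → (I.1 : FractionalIdeal (𝓞 E)⁰ E) * rep C = FractionalIdeal.spanSingleton (𝓞 E)⁰ x → C = C0 := by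
    intro C x hx h
    have h1 : ClassGroup.mk E (U * rep C) = 1 := by
      rw [ClassGroup.mk_eq_one_iff, Units.val_mul, hU, h]
      rw [FractionalIdeal.isPrincipal_iff]
      exact ⟨x, rfl⟩
    rw [map_mul, hrep] at h1
    rw [hC0]; exact eq_inv_of_mul_eq_one_right h1
  have h1 : ClassGroup.mk E (U * rep C0) = 1 := by
    rw [map_mul, hrep, hC0, mul_inv_cancel]
  rw [ClassGroup.mk_eq_one_iff, FractionalIdeal.isPrincipal_iff] at h1
  obtain ⟨x0, hx0⟩ := h1
  rw [Units.val_mul, hU] at hx0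
  have hx00 : x0 ≠ 0 := by
    rintro rfl
    rw [FractionalIdeal.spanSingleton_zero, ← hU, ← Units.val_mul] at hx0
    exact (U * rep C0).ne_zero hx0
  have hsm : ∀ u : (𝓞 E)ˣ, FractionalIdeal.spanSingleton (𝓞 E)⁰ (u • x0) = FractionalIdeal.spanSingleton (𝓞 E)⁰ x0 := fun u =>
    (FractionalIdeal.spanSingleton_eq_spanSingleton.2 ⟨u, rfl⟩).symm
  have hmem : ∀ u : (𝓞 E)ˣ, u • x0 ∈ (rep C0 : FractionalIdeal (𝓞 E)⁰ E) := by
    intro u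
    rw [← FractionalIdeal.spanSingleton_le_iff_mem, hsm, ← hx0]
    calc (I.1 : FractionalIdeal (𝓞 E)⁰ E) * rep C0 ≤ 1 * rep C0 :=
        mul_le_mul_left FractionalIdeal.coeIdeal_le_one _
      _ = rep C0 := one_mul _
  have hne : ∀ u : (𝓞 E)ˣ, u • x0 ≠ 0 := fun u h => hx00 ((smul_eq_zero_iff_eq u).1 h)
  refine ⟨Equiv.ofBijective (fun u => ⟨⟨C0, ⟨u • x0, hmem u, hne u⟩⟩, ?_⟩) ⟨?_, ?_⟩⟩
  · rw [PhiI_eq_iff]; simp only [hsm]; exact hx0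
  · intro u v huv
    simp only [Subtype.mk.injEq, Sigma.mk.injEq, heq_eq_eq, true_and] at huv
    rw [Units.smul_def, Units.smul_def, Algebra.smul_def, Algebra.smul_def] at huv
    have := mul_right_cancel₀ hx00 huv
    exact Units.ext (FaithfulSMul.algebraMap_injective (𝓞 E) E this)
  · rintro ⟨⟨C, x, hx, hx1⟩, h⟩
    rw [PhiI_eq_iff] at h
    simp only at h
    have hC := hone C x hx1 h
    subst hC
    rw [hx0, FractionalIdeal.spanSingleton_eq_spanSingleton] at h
    obtain ⟨u, rfl⟩ := h
    exact ⟨u, rfl⟩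

lemma idx_norm (hdeg : Module.finrank ℚ E = 2) (hneg : NumberField.discr E < 0) (ι : E →+* ℂ)
    (rep : ClassGroup (𝓞 E) → (FractionalIdeal (𝓞 E)⁰ E)ˣ) (p : Idx rep) :
    ((Ideal.absNorm (PhiI rep p).1 : ℕ) : ℝ) * ((FractionalIdeal.absNorm (rep p.1 : FractionalIdeal (𝓞 E)⁰ E) : ℚ) : ℝ) = ‖ι p.2.1‖ ^ 2 := by
  have h := congrArg FractionalIdeal.absNorm (PhiI_spec rep p)
  rw [map_mul, FractionalIdeal.coeIdeal_absNorm, FractionalIdeal.absNorm_span_singleton] at h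
  rw [← norm_emb hdeg hneg ι, ← h]
  push_cast; rfl

lemma absNorm_pos (𝔞 : (FractionalIdeal (𝓞 E)⁰ E)ˣ) : (0:ℝ) < ((FractionalIdeal.absNorm (𝔞 : FractionalIdeal (𝓞 E)⁰ E) : ℚ) : ℝ) := by
  have h1 := FractionalIdeal.absNorm_nonneg (𝔞 : FractionalIdeal (𝓞 E)⁰ E)
  have h2 : FractionalIdeal.absNorm (𝔞 : FractionalIdeal (𝓞 E)⁰ E) ≠ 0 := by
    rw [Ne, FractionalIdeal.absNorm_eq_zero_iff]; exact 𝔞.ne_zero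
  exact_mod_cast lt_of_le_of_ne h1 h2.symm
end bij
end CSF
end

section
open Filter Topology Asymptotics Set MeasureTheory
open NumberField
open scoped nonZeroDivisors
namespace CSF
section sums
variable {E : Type*} [Field E] [NumberField E]

lemma basis_unique (ι : E →+* ℂ) {a b : E} (hb : ι b ≠ 0) (him : 0 < (ι a / ι b).im) {m n m' n' : ℤ}
    (h : (m : E) * a + n * b = m' * a + n' * b) : m = m' ∧ n = n' := by
  have h1 := congrArg ι h
  simp only [map_add, map_mul, map_intCast] at h1
  have h2 : (m : ℂ) * (ι a / ι b) + n = m' * (ι a / ι b) + n' := by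
    field_simp
    linear_combination h1
  have h3 := congrArg Complex.im h2
  simp only [Complex.add_im, Complex.mul_im, Complex.intCast_re, Complex.intCast_im, zero_mul, add_zero] at h3
  have h4 : (m : ℝ) = m' := mul_right_cancel₀ him.ne' h3
  have h5 : m = m' := by exact_mod_cast h4
  subst h5
  refine ⟨rfl, ?_⟩
  have := add_left_cancel h2
  exact_mod_cast this

lemma norm_lat (ι : E →+* ℂ) {a b : E} (hb : ι b ≠ 0) (m n : ℤ) :
    ‖ι ((m : E) * a + n * b)‖ ^ 2 =
      ‖ι b‖ ^ 2 * ((n + m * (ι a / ι b).re) ^ 2 + (m * (ι a / ι b).im) ^ 2) := by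
  have h1 : ι ((m : E) * a + n * b) = ι b * ((m : ℂ) * (ι a / ι b) + n) := by
    simp only [map_add, map_mul, map_intCast]
    field_simp
  rw [h1, norm_mul, mul_pow]
  congr 1
  rw [← Complex.normSq_eq_norm_sq, Complex.normSq_apply]
  simp only [Complex.add_im, Complex.add_re, Complex.mul_re, Complex.mul_im, Complex.intCast_re, Complex.intCast_im, zero_mul, add_zero, sub_zero]
  ring

lemma lat_hasSum (ι : E →+* ℂ) (𝔞 : FractionalIdeal (𝓞 E)⁰ E) {a b : E} (hb : ι b ≠ 0) (him : 0 < (ι a / ι b).im)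
    (hmem : ∀ x, x ∈ 𝔞 ↔ ∃ m n : ℤ, x = m * a + n * b) {s : ℂ} (hs : 1 < s.re) :
    HasSum (fun x : {x : E // x ∈ 𝔞 ∧ x ≠ 0} => ((‖ι x.1‖ ^ 2 : ℝ) : ℂ) ^ (-s))
      (((‖ι b‖ ^ 2 : ℝ) : ℂ) ^ (-s) * ZZ (ι a / ι b).re (ι a / ι b).im s) := by
  have hs0 : s ≠ 0 := by rintro rfl; simp at hs; linarith
  have h1 := (ZZ_hasSum (ι a / ι b).re him hs).mul_left (((‖ι b‖ ^ 2 : ℝ) : ℂ) ^ (-s))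
  have h2 : HasSum (fun p : ℤ × ℤ => ((‖ι ((p.1 : E) * a + p.2 * b)‖ ^ 2 : ℝ) : ℂ) ^ (-s))
      (((‖ι b‖ ^ 2 : ℝ) : ℂ) ^ (-s) * ZZ (ι a / ι b).re (ι a / ι b).im s) := by
    refine h1.congr_fun fun p => ?_
    rw [norm_lat ι hb, Complex.ofReal_mul, Complex.mul_cpow_ofReal_nonneg (by positivity) (by positivity)]
  have hx : ∀ x : {x : E // x ∈ 𝔞 ∧ x ≠ 0}, ∃ p : ℤ × ℤ, x.1 = p.1 * a + p.2 * b := fun x => by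
    obtain ⟨m, n, h⟩ := (hmem x.1).1 x.2.1
    exact ⟨(m, n), h⟩
  choose g hg using hx
  have hinj : Function.Injective g := fun x y h => Subtype.ext (by rw [hg x, hg y, h])
  have h3 := (hinj.hasSum_iff (f := fun p : ℤ × ℤ => ((‖ι ((p.1 : E) * a + p.2 * b)‖ ^ 2 : ℝ) : ℂ) ^ (-s))
    (a := (((‖ι b‖ ^ 2 : ℝ) : ℂ) ^ (-s) * ZZ (ι a / ι b).re (ι a / ι b).im s)) ?_).2 h2
  · refine h3.congr_fun fun x => ?_
    simp only [Function.comp]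
    rw [← hg x]
  · rintro ⟨m, n⟩ hp
    by_cases h0 : (m : E) * a + n * b = 0
    · simp [h0, hs0]
    · exfalso
      apply hp
      refine ⟨⟨(m : E) * a + n * b, (hmem _).2 ⟨m, n, rfl⟩, h0⟩, ?_⟩
      have := basis_unique ι hb him (hg ⟨(m : E) * a + n * b, (hmem _).2 ⟨m, n, rfl⟩, h0⟩)
      exact Prod.ext this.1.symm this.2.symm

lemma idx_hasSum (hdeg : Module.finrank ℚ E = 2) (hneg : NumberField.discr E < 0) (ι : E →+* ℂ)
    (rep : ClassGroup (𝓞 E) → (FractionalIdeal (𝓞 E)⁰ E)ˣ) (a b : ClassGroup (𝓞 E) → E)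
    (hb : ∀ C, ι (b C) ≠ 0) (him : ∀ C, 0 < (ι (a C) / ι (b C)).im)
    (hmem : ∀ C x, x ∈ (rep C : FractionalIdeal (𝓞 E)⁰ E) ↔ ∃ m n : ℤ, x = m * a C + n * b C) {s : ℂ} (hs : 1 < s.re) :
    HasSum (fun p : Idx rep => ((Ideal.absNorm (PhiI rep p).1 : ℕ) : ℂ) ^ (-s))
      (∑ C, (((FractionalIdeal.absNorm (rep C : FractionalIdeal (𝓞 E)⁰ E) : ℚ) : ℝ) : ℂ) ^ s *
        (((‖ι (b C)‖ ^ 2 : ℝ) : ℂ) ^ (-s) * ZZ (ι (a C) / ι (b C)).re (ι (a C) / ι (b C)).im s)) := by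
  have hterm : ∀ p : Idx rep, ((Ideal.absNorm (PhiI rep p).1 : ℕ) : ℂ) ^ (-s) =
      (((FractionalIdeal.absNorm (rep p.1 : FractionalIdeal (𝓞 E)⁰ E) : ℚ) : ℝ) : ℂ) ^ s * ((‖ι p.2.1‖ ^ 2 : ℝ) : ℂ) ^ (-s) := by
    intro p
    have hN := absNorm_pos (rep p.1)
    rw [← idx_norm hdeg hneg ι rep p, Complex.ofReal_mul, Complex.mul_cpow_ofReal_nonneg (by positivity) hN.le,
      Complex.cpow_neg (((FractionalIdeal.absNorm (rep p.1 : FractionalIdeal (𝓞 E)⁰ E) : ℚ) : ℝ) : ℂ), Complex.ofReal_natCast]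
    have h0 : (((FractionalIdeal.absNorm (rep p.1 : FractionalIdeal (𝓞 E)⁰ E) : ℚ) : ℝ) : ℂ) ^ s ≠ 0 := by
      rw [Complex.cpow_ne_zero_iff]; left; exact_mod_cast hN.ne'
    field_simp
  have hin : ∀ C, HasSum (fun x : {x : E // x ∈ (rep C : FractionalIdeal (𝓞 E)⁰ E) ∧ x ≠ 0} =>
      ((Ideal.absNorm (PhiI rep ⟨C, x⟩).1 : ℕ) : ℂ) ^ (-s))
      ((((FractionalIdeal.absNorm (rep C : FractionalIdeal (𝓞 E)⁰ E) : ℚ) : ℝ) : ℂ) ^ s *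
        (((‖ι (b C)‖ ^ 2 : ℝ) : ℂ) ^ (-s) * ZZ (ι (a C) / ι (b C)).re (ι (a C) / ι (b C)).im s)) := fun C =>
    ((lat_hasSum ι _ (hb C) (him C) (hmem C) hs).mul_left _).congr_fun fun x => hterm ⟨C, x⟩
  have hsum : Summable (fun p : Idx rep => ((Ideal.absNorm (PhiI rep p).1 : ℕ) : ℂ) ^ (-s)) := by
    refine Summable.of_norm ?_
    rw [summable_sigma_of_nonneg (fun _ => norm_nonneg _)]
    exact ⟨fun C => (hin C).summable.norm, (hasSum_fintype _).summable⟩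
  have h1 := hsum.hasSum
  exact h1.trans_val ((hasSum_fintype _).unique (h1.sigma hin))

lemma class_zeta {d : ℕ} [NeZero d] (hdeg : Module.finrank ℚ E = 2)
    (hdisc : NumberField.discr E = -(d : ℤ)) (χ : DirichletCharacter ℂ d)
    (hχquad : ∀ u : (ZMod d)ˣ, χ u = 1 ∨ χ u = -1)
    (hχ : ∀ p : ℕ, p.Prime → ¬ p ∣ d →
      (χ (p : ZMod d) = -1 ↔ (Ideal.span {(p : 𝓞 E)} : Ideal (𝓞 E)).IsPrime))
    (hneg : NumberField.discr E < 0) (ι : E →+* ℂ)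
    (rep : ClassGroup (𝓞 E) → (FractionalIdeal (𝓞 E)⁰ E)ˣ)
    (hrep : ∀ C, ClassGroup.mk E (rep C) = C) (a b : ClassGroup (𝓞 E) → E)
    (hb : ∀ C, ι (b C) ≠ 0) (him : ∀ C, 0 < (ι (a C) / ι (b C)).im)
    (hmem : ∀ C x, x ∈ (rep C : FractionalIdeal (𝓞 E)⁰ E) ↔ ∃ m n : ℤ, x = m * a C + n * b C) {s : ℂ} (hs : 1 < s.re) :
    ∑ C, (((FractionalIdeal.absNorm (rep C : FractionalIdeal (𝓞 E)⁰ E) : ℚ) : ℝ) : ℂ) ^ s *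
        (((‖ι (b C)‖ ^ 2 : ℝ) : ℂ) ^ (-s) * ZZ (ι (a C) / ι (b C)).re (ι (a C) / ι (b C)).im s) =
      (Nat.card (𝓞 E)ˣ : ℂ) * (riemannZeta s * DirichletCharacter.LFunction χ s) ∧ Nat.card (𝓞 E)ˣ ≠ 0 := by
  have h1 := idx_hasSum hdeg hneg ι rep a b hb him hmem hs
  have h2 := (Equiv.hasSum_iff (Equiv.sigmaFiberEquiv (PhiI rep)) (f := fun p : Idx rep => ((Ideal.absNorm (PhiI rep p).1 : ℕ) : ℂ) ^ (-s))).2 h1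
  have hfib : ∀ I (p : {p // PhiI rep p = I}), ((Ideal.absNorm (PhiI rep p.1).1 : ℕ) : ℂ) ^ (-s) =
      ((Ideal.absNorm I.1 : ℕ) : ℂ) ^ (-s) := by
    rintro I ⟨p, rfl⟩; rfl
  have hfin : Finite (𝓞 E)ˣ := by
    have hs1 := h2.summable.sigma_factor (⟨⊤, top_ne_bot⟩ : {I : Ideal (𝓞 E) // I ≠ ⊥})
    obtain ⟨e⟩ := fiber_equiv rep hrep (⟨⊤, top_ne_bot⟩ : {I : Ideal (𝓞 E) // I ≠ ⊥})
    have hs2 : Summable (fun _ : (𝓞 E)ˣ => (1 : ℂ)) := by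
      rw [← e.summable_iff] at hs1
      refine hs1.congr fun u => ?_
      simp only [Function.comp, Equiv.sigmaFiberEquiv_apply]
      rw [hfib]
      simp
    by_contra hinf
    rw [not_finite_iff_infinite] at hinf
    exact one_ne_zero ((summable_const_iff (1:ℂ)).1 hs2)
  refine ⟨?_, Nat.card_pos.ne'⟩
  have h3 := h2.sigma (g := fun I : {I : Ideal (𝓞 E) // I ≠ ⊥} => (Nat.card (𝓞 E)ˣ : ℂ) * ((Ideal.absNorm I.1 : ℕ) : ℂ) ^ (-s)) ?_
  · exact h3.unique ((ideal_zeta hdeg hdisc χ hχquad hχ hs).mul_left _)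
  · intro I
    obtain ⟨e⟩ := fiber_equiv rep hrep I
    rw [← e.hasSum_iff]
    have := Fintype.ofFinite (𝓞 E)ˣ
    refine (hasSum_fintype _).trans_val ?_
    simp only [Function.comp, Equiv.sigmaFiberEquiv_apply]
    rw [Finset.sum_congr rfl (fun u _ => hfib I (e u))]
    simp [Nat.card_eq_fintype_card]
end sums
end CSF
end

section
open Filter Topology Asymptotics Set MeasureTheory
open NumberField
open scoped nonZeroDivisors
namespace CSF
section final
variable {E : Type*} [Field E] [NumberField E]

lemma identity_ext {F G : ℂ → ℂ} (hF : ∀ s, s ≠ 1/2 → s ≠ 1 → DifferentiableAt ℂ F s)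
    (hG : ∀ s, s ≠ 1/2 → s ≠ 1 → DifferentiableAt ℂ G s) (h : ∀ s : ℂ, 1 < s.re → F s = G s) :
    F =ᶠ[𝓝 0] G := by
  have hc : ({1/2, 1} : Set ℂ).Countable := (Set.toFinite _).countable
  have hopen : IsOpen ({1/2, 1} : Set ℂ)ᶜ := (Set.toFinite _).isClosed.isOpen_compl
  have hconn : IsPreconnected ({1/2, 1} : Set ℂ)ᶜ :=
    (hc.isPathConnected_compl_of_one_lt_rank (by rw [Complex.rank_real_complex]; norm_num)).isConnected.isPreconnected
  have hFa : AnalyticOnNhd ℂ F ({1/2, 1} : Set ℂ)ᶜ := by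
    refine DifferentiableOn.analyticOnNhd (fun s hs => ?_) hopen
    simp only [mem_compl_iff, mem_insert_iff, mem_singleton_iff, not_or] at hs
    exact (hF s hs.1 hs.2).differentiableWithinAt
  have hGa : AnalyticOnNhd ℂ G ({1/2, 1} : Set ℂ)ᶜ := by
    refine DifferentiableOn.analyticOnNhd (fun s hs => ?_) hopen
    simp only [mem_compl_iff, mem_insert_iff, mem_singleton_iff, not_or] at hs
    exact (hG s hs.1 hs.2).differentiableWithinAt
  have h2 : (2 : ℂ) ∈ ({1/2, 1} : Set ℂ)ᶜ := by
    simp only [mem_compl_iff, mem_insert_iff, mem_singleton_iff, not_or]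
    constructor <;> norm_num
  have h0 : (0 : ℂ) ∈ ({1/2, 1} : Set ℂ)ᶜ := by
    simp only [mem_compl_iff, mem_insert_iff, mem_singleton_iff, not_or]
    constructor <;> norm_num
  have hev : F =ᶠ[𝓝 2] G := by
    have : {s : ℂ | 1 < s.re} ∈ 𝓝 (2 : ℂ) :=
      (isOpen_lt continuous_const Complex.continuous_re).mem_nhds (by simp)
    filter_upwards [this] with s hs using h s hs
  have key := hFa.eqOn_of_preconnected_of_eventuallyEq hGa hconn h2 hev
  filter_upwards [hopen.mem_nhds h0] with s hs using key hs

lemma half_formula {d : ℕ} [NeZero d] (hdeg : Module.finrank ℚ E = 2)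
    (hdisc : NumberField.discr E = -(d : ℤ)) (χ : DirichletCharacter ℂ d)
    (hχquad : ∀ u : (ZMod d)ˣ, χ u = 1 ∨ χ u = -1)
    (hχ : ∀ p : ℕ, p.Prime → ¬ p ∣ d →
      (χ (p : ZMod d) = -1 ↔ (Ideal.span {(p : 𝓞 E)} : Ideal (𝓞 E)).IsPrime))
    (hneg : NumberField.discr E < 0) (ι : E →+* ℂ)
    (hL0 : DirichletCharacter.LFunction χ 0 ≠ 0)
    (D : FractionalIdeal (𝓞 E)⁰ E → ℂ)
    (hD : ∀ (𝔞 : FractionalIdeal (𝓞 E)⁰ E) (ω₁ ω₂ : ℂ), ω₂ ≠ 0 → 0 < (ω₁ / ω₂).im →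
      (∀ z : ℂ, (∃ x : E, x ∈ 𝔞 ∧ ι x = z) ↔ ∃ m n : ℤ, z = m * ω₁ + n * ω₂) →
      D 𝔞 = ω₂ ^ (-12 : ℤ) * RamanujanDelta (ω₁ / ω₂))
    (rep : ClassGroup (𝓞 E) → (FractionalIdeal (𝓞 E)⁰ E)ˣ)
    (hrep : ∀ C, ClassGroup.mk E (rep C) = C) :
    (∀ C, D (rep C) ≠ 0) ∧
    ((∑ C, (Real.log ((FractionalIdeal.absNorm (rep C : FractionalIdeal (𝓞 E)⁰ E) : ℚ) : ℝ) +
      1/6 * Real.log ‖D (rep C)‖) : ℝ) : ℂ) =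
      (Fintype.card (ClassGroup (𝓞 E)) : ℂ) * (deriv (DirichletCharacter.LFunction χ) 0 /
          DirichletCharacter.LFunction χ 0 - (Real.log (2 * Real.pi) : ℝ)) := by
  have hbas := fun C => basis_exists hdeg hneg ι (rep C)
  choose a b hb him hmem using hbas
  have hDval : ∀ C, D (rep C) = (ι (b C)) ^ (-12 : ℤ) * RamanujanDelta (ι (a C) / ι (b C)) := by
    intro C
    refine hD _ _ _ (hb C) (him C) fun z => ?_
    constructor
    · rintro ⟨x, hx, rfl⟩
      obtain ⟨m, n, rfl⟩ := (hmem C x).1 hx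
      exact ⟨m, n, by simp⟩
    · rintro ⟨m, n, rfl⟩
      exact ⟨m * a C + n * b C, (hmem C _).2 ⟨m, n, rfl⟩, by simp⟩
  have hR : ∀ C, RamanujanDelta (ι (a C) / ι (b C)) ≠ 0 := by
    intro C
    obtain ⟨S, h⟩ := HH_zero (ι (a C) / ι (b C)).re (him C)
    exact h.2.2
  have hDne : ∀ C, D (rep C) ≠ 0 := fun C => by
    rw [hDval]; exact mul_ne_zero (zpow_ne_zero _ (hb C)) (hR C)
  have hlogD : ∀ C, Real.log ‖D (rep C)‖ = -12 * Real.log ‖ι (b C)‖ + Real.log ‖RamanujanDelta (ι (a C) / ι (b C))‖ := by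
    intro C
    rw [hDval, norm_mul, Real.log_mul (by simpa using hb C) (by simpa using hR C), norm_zpow, Real.log_zpow]
    push_cast; ring
  refine ⟨hDne, ?_⟩
  set W : ℂ := (Nat.card (𝓞 E)ˣ : ℂ) with hW
  let N : ClassGroup (𝓞 E) → ℝ := fun C => ((FractionalIdeal.absNorm (rep C : FractionalIdeal (𝓞 E)⁰ E) : ℚ) : ℝ)
  have hN : ∀ C, 0 < N C := fun C => absNorm_pos (rep C)
  have hB : ∀ C, 0 < ‖ι (b C)‖ ^ 2 := fun C => by have := norm_pos_iff.2 (hb C); positivity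
  let F : ℂ → ℂ := fun s => ∑ C, ((N C : ℝ) : ℂ) ^ s *
        (((‖ι (b C)‖ ^ 2 : ℝ) : ℂ) ^ (-s) * ZZ (ι (a C) / ι (b C)).re (ι (a C) / ι (b C)).im s)
  let G : ℂ → ℂ := fun s => W * (riemannZeta s * DirichletCharacter.LFunction χ s)
  have hcz := fun (s : ℂ) (hs : 1 < s.re) => class_zeta hdeg hdisc χ hχquad hχ hneg ι rep hrep a b hb him hmem hs
  have hN1 : ∀ C, HasDerivAt (fun s : ℂ => ((N C : ℝ) : ℂ) ^ s) (Real.log (N C) : ℂ) 0 := by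
    intro C
    have h := (hasDerivAt_id (0:ℂ)).const_cpow (c := ((N C : ℝ) : ℂ)) (Or.inl (by exact_mod_cast (hN C).ne'))
    refine h.congr_deriv ?_
    simp [Complex.ofReal_log (hN C).le]
  have hB1 : ∀ C, HasDerivAt (fun s : ℂ => ((‖ι (b C)‖ ^ 2 : ℝ) : ℂ) ^ (-s)) (-(2 * Real.log ‖ι (b C)‖ : ℝ) : ℂ) 0 := by
    intro C
    have h := (hasDerivAt_neg (0:ℂ)).const_cpow (c := ((‖ι (b C)‖ ^ 2 : ℝ) : ℂ)) (Or.inl (by exact_mod_cast (hB C).ne'))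
    refine h.congr_deriv ?_
    rw [← Complex.ofReal_log (hB C).le, Real.log_pow]
    simp
  have hFd : ∀ s, s ≠ 1/2 → s ≠ 1 → DifferentiableAt ℂ F s := by
    intro s h1 h2
    refine DifferentiableAt.fun_sum fun C _ => ?_
    refine DifferentiableAt.fun_mul ?_ (DifferentiableAt.fun_mul ?_ (ZZ_diff _ (him C) h1 h2))
    · exact differentiableAt_id.const_cpow (Or.inl (by exact_mod_cast (hN C).ne'))
    · exact differentiableAt_id.neg.const_cpow (Or.inl (by exact_mod_cast (hB C).ne'))
  have hGd : ∀ s, s ≠ 1/2 → s ≠ 1 → DifferentiableAt ℂ G s := by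
    intro s h1 h2
    exact ((differentiableAt_riemannZeta h2).fun_mul (DirichletCharacter.differentiableAt_LFunction χ s (Or.inl h2))).const_mul W
  have hFG : F =ᶠ[𝓝 0] G := identity_ext hFd hGd fun s hs => (hcz s hs).1
  have hF0 : F 0 = -(Fintype.card (ClassGroup (𝓞 E)) : ℂ) := by
    simp [F, ZZ_zero]
  have hG0 : G 0 = -(W * DirichletCharacter.LFunction χ 0 / 2) := by
    simp only [G, riemannZeta_zero]; ring
  have hFder : HasDerivAt F (∑ C, ((-Real.log (N C) + 2 * Real.log ‖ι (b C)‖ + (-2*Real.log (2*Real.pi) - 1/6*Real.log ‖RamanujanDelta (ι (a C) / ι (b C))‖) : ℝ) : ℂ)) 0 := by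
    refine HasDerivAt.fun_sum fun C _ => ?_
    have hz : HasDerivAt (ZZ (ι (a C) / ι (b C)).re (ι (a C) / ι (b C)).im) ((-2*Real.log (2*Real.pi) - 1/6*Real.log ‖RamanujanDelta (ι (a C) / ι (b C))‖ : ℝ):ℂ) 0 :=
      ZZ_deriv _ (him C)
    refine ((hN1 C).fun_mul ((hB1 C).fun_mul hz)).congr_deriv ?_
    rw [ZZ_zero]
    simp only [neg_zero, Complex.cpow_zero]
    push_cast; ring
  have hGder : HasDerivAt G (W * (deriv riemannZeta 0 * DirichletCharacter.LFunction χ 0 + riemannZeta 0 * deriv (DirichletCharacter.LFunction χ) 0)) 0 :=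
    (((differentiableAt_riemannZeta zero_ne_one).hasDerivAt).fun_mul
      ((DirichletCharacter.differentiableAt_LFunction χ 0 (Or.inl zero_ne_one)).hasDerivAt)).const_mul W
  have e1 : (Fintype.card (ClassGroup (𝓞 E)) : ℂ) = W * DirichletCharacter.LFunction χ 0 / 2 := by
    have := hFG.eq_of_nhds
    rw [hF0, hG0] at this
    exact neg_injective this
  have e2 := hFder.unique (hGder.congr_of_eventuallyEq hFG)
  rw [deriv_riemannZeta_zero, riemannZeta_zero] at e2
  have e3 : ∀ C, (-Real.log (N C) + 2 * Real.log ‖ι (b C)‖ + (-2*Real.log (2*Real.pi) - 1/6*Real.log ‖RamanujanDelta (ι (a C) / ι (b C))‖)) =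
      -(Real.log (N C) + 1/6 * Real.log ‖D (rep C)‖) - 2 * Real.log (2 * Real.pi) := by
    intro C; rw [hlogD]; ring
  rw [Finset.sum_congr rfl (fun C _ => by rw [e3 C])] at e2
  rw [← Complex.ofReal_sum, Finset.sum_sub_distrib, Finset.sum_neg_distrib, Finset.sum_const, Finset.card_univ, nsmul_eq_mul] at e2
  have e4 : ((Real.log (2 * Real.pi) : ℝ) : ℂ) = Complex.log (2 * Real.pi) := by
    rw [Complex.ofReal_log (by positivity)]; push_cast; rfl
  rw [Complex.ofReal_sub, Complex.ofReal_neg] at e2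
  change ((∑ C, (Real.log (N C) + 1/6 * Real.log ‖D (rep C)‖) : ℝ) : ℂ) = _
  generalize ((∑ C, (Real.log (N C) + 1/6 * Real.log ‖D (rep C)‖) : ℝ) : ℂ) = X at e2 ⊢
  push_cast [← e4] at e2
  push_cast [← e4]
  rw [← e4] at *
  generalize ((Real.log (2 * Real.pi) : ℝ) : ℂ) = Lg at *
  rw [e1] at e2 ⊢
  field_simp
  linear_combination -2 * e2
end final
end CSF
end

/-- **The Chowla–Selberg formula, reformulated.**
`E` is an imaginary quadratic field of discriminant `−d`, embedded in `ℂ` via `ι`, with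
class number `h` and attached primitive quadratic Dirichlet character `χ` modulo `d`.
`D 𝔞 = Δ(𝔞)` is the value of Ramanujan's discriminant on the lattice
`ι(𝔞) = ℤω₁ + ℤω₂ ⊂ ℂ`, and `rep` selects a representative fractional ideal of each ideal
class.  Then `(1/(24h)) Σ_{𝔞 ∈ CL(E)} log|Δ(𝔞)Δ(𝔞⁻¹)| = (1/2)·L'(0,χ)/L(0,χ) − (1/2)·log(2π)`,
`L(s,χ)` being the analytically continued Dirichlet L-function of `χ`. -/
theorem chowla_selberg_faltings_form
    (E : Type*) [Field E] [NumberField E] (ι : E →+* ℂ)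
    (d : ℕ) (hd : 0 < d) [NeZero d]
    (hdeg : Module.finrank ℚ E = 2)
    (hdisc : NumberField.discr E = -(d : ℤ))
    (h w : ℕ)
    (hh : h = NumberField.classNumber E)
    (hw : w = Nat.card (NumberField.Units.torsion E))
    (χ : DirichletCharacter ℂ d)
    (hχprim : χ.IsPrimitive)
    (hχquad : ∀ u : (ZMod d)ˣ, χ u = 1 ∨ χ u = -1)
    (hχ : ∀ p : ℕ, p.Prime → ¬ p ∣ d →
      (χ (p : ZMod d) = -1 ↔ (Ideal.span {(p : 𝓞 E)} : Ideal (𝓞 E)).IsPrime))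
    (hL0 : DirichletCharacter.LFunction χ 0 ≠ 0)
    (D : FractionalIdeal (𝓞 E)⁰ E → ℂ)
    (hD : ∀ (𝔞 : FractionalIdeal (𝓞 E)⁰ E) (ω₁ ω₂ : ℂ), ω₂ ≠ 0 → 0 < (ω₁ / ω₂).im →
      (∀ z : ℂ, (∃ x : E, x ∈ 𝔞 ∧ ι x = z) ↔ ∃ m n : ℤ, z = m * ω₁ + n * ω₂) →
      D 𝔞 = ω₂ ^ (-12 : ℤ) * RamanujanDelta (ω₁ / ω₂))
    (rep : ClassGroup (𝓞 E) → (FractionalIdeal (𝓞 E)⁰ E)ˣ)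
    (hrep : ∀ C, ClassGroup.mk E (rep C) = C) :
    ((1 / (24 * h) : ℝ) : ℂ) *
        ∑ C : ClassGroup (𝓞 E), (Real.log ‖D ↑(rep C) * D ↑((rep C)⁻¹)‖ : ℂ) =
      (1 / 2 : ℂ) * (deriv (DirichletCharacter.LFunction χ) 0 /
          DirichletCharacter.LFunction χ 0) -
        (1 / 2 : ℂ) * (Real.log (2 * Real.pi) : ℂ) := by
  have hneg : NumberField.discr E < 0 := by rw [hdisc]; simpa using hd
  obtain ⟨hD1, hS1⟩ := CSF.half_formula hdeg hdisc χ hχquad hχ hneg ι hL0 D hD rep hrep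
  obtain ⟨hD2, hS2⟩ := CSF.half_formula hdeg hdisc χ hχquad hχ hneg ι hL0 D hD
    (fun C => (rep C⁻¹)⁻¹) (fun C => by rw [map_inv, hrep, inv_inv])
  have hD2' : ∀ C, D ↑((rep C)⁻¹) ≠ 0 := fun C => by simpa using hD2 C⁻¹
  have hS2' : ∑ C : ClassGroup (𝓞 E), (Real.log ((FractionalIdeal.absNorm
        (((rep C⁻¹)⁻¹ : (FractionalIdeal (𝓞 E)⁰ E)ˣ) : FractionalIdeal (𝓞 E)⁰ E) : ℚ) : ℝ) +
      1/6 * Real.log ‖D ↑((rep C⁻¹)⁻¹)‖) =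
      ∑ C : ClassGroup (𝓞 E), (-Real.log ((FractionalIdeal.absNorm
        (rep C : FractionalIdeal (𝓞 E)⁰ E) : ℚ) : ℝ) + 1/6 * Real.log ‖D ↑((rep C)⁻¹)‖) := by
    refine Fintype.sum_equiv (Equiv.inv _) _ _ fun C => ?_
    simp only [Equiv.inv_apply]
    rw [Units.val_inv_eq_inv_val, map_inv₀, Rat.cast_inv, Real.log_inv]
  rw [hS2'] at hS2
  have hcard : (h : ℂ) = (Fintype.card (ClassGroup (𝓞 E)) : ℂ) := by
    rw [hh]; rfl
  have hh0 : (h : ℂ) ≠ 0 := by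
    rw [hcard]; exact_mod_cast Fintype.card_ne_zero
  have hsum : (∑ C : ClassGroup (𝓞 E), (Real.log ‖D ↑(rep C) * D ↑((rep C)⁻¹)‖ : ℂ)) =
      6 * (((∑ C, (Real.log ((FractionalIdeal.absNorm (rep C : FractionalIdeal (𝓞 E)⁰ E) : ℚ) : ℝ) +
      1/6 * Real.log ‖D (rep C)‖) : ℝ) : ℂ) + ((∑ C : ClassGroup (𝓞 E), (-Real.log ((FractionalIdeal.absNorm
        (rep C : FractionalIdeal (𝓞 E)⁰ E) : ℚ) : ℝ) + 1/6 * Real.log ‖D ↑((rep C)⁻¹)‖) : ℝ) : ℂ)) := by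
    rw [← Complex.ofReal_add, ← Finset.sum_add_distrib, Complex.ofReal_sum, Finset.mul_sum]
    refine Finset.sum_congr rfl fun C _ => ?_
    rw [norm_mul, Real.log_mul (norm_ne_zero_iff.2 (hD1 C)) (norm_ne_zero_iff.2 (hD2' C))]
    push_cast
    ring
  rw [hsum, hS1, hS2, ← hcard]
  push_cast
  field_simp
  ring
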